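/- arXiv:1909.12559 — 4 statements merged into one kernel-verified Lean document; each statement's English description precedes it below -/
import Mathlib

section
/- Under the stated curvature hypothesis on the phase φ, there is a constant C (depending only on k, φ, β, f, χ and the constants c, C_m, but independent of h, a, j and the points) such that for every h ∈ (0,1], every integer j ≥ 1 with 2^j h^{1/(k+1)} ≤ 1, every a > 0, and all (x₁,x₂), (z₁,z₂) ∈ ℝ², the kernel K_j(x₁,x₂,z₁,z₂) := (2πh)^{−1} ∬_{ℝ²} e^{i(φ(x₁,x₂,ξ₂) − φ(z₁,z₂,ξ₂))/h} f(a^{−1}(x₁ − b)) · conj(f(a^{−1}(z₁ − b))) · χ(2^{−j} h^{−1/(k+1)}|ξ₂|)² · β(x₁,x₂,ξ₂) · conj(β(z₁,z₂,ξ₂)) dξ₂ db satisfies: |K_j(x₁,x₂,z₁,z₂)| ≤ C a 2^j h^{−1 + 1/(k+1)} whenever |x₁ − z₁| ≤ 2^{−2j} h^{1 − 2/(k+1)}, and |K_j(x₁,x₂,z₁,z₂)| ≤ C a h^{−1/2} |x₁ − z₁|^{−1/2} whenever |x₁ − z₁| ≥ 2^{−2j} h^{1 − 2/(k+1)}. 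-/
open MeasureTheory Real
open scoped ENNReal

/-- The frozen-time kernel
`K_j(x₁,x₂,z₁,z₂) = (2πh)^{-1} ∬ e^{i(φ(x₁,x₂,ξ₂)-φ(z₁,z₂,ξ₂))/h} f(a⁻¹(x₁-b))
conj(f(a⁻¹(z₁-b))) χ(2⁻ʲ h^{-1/(k+1)}|ξ₂|)² β(x₁,x₂,ξ₂) conj(β(z₁,z₂,ξ₂)) dξ₂ db`. -/
noncomputable def Kj (h a : ℝ) (j k : ℕ)
    (φ : ℝ × ℝ × ℝ → ℝ) (β : ℝ × ℝ × ℝ → ℂ) (f : ℝ → ℂ) (χ : ℝ → ℝ)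
    (x₁ x₂ z₁ z₂ : ℝ) : ℂ :=
  (((2 * π * h)⁻¹ : ℝ) : ℂ) *
    ∫ p : ℝ × ℝ,
      Complex.exp (Complex.I * ((φ (x₁, x₂, p.1) - φ (z₁, z₂, p.1) : ℝ) : ℂ) / (h : ℂ)) *
        f ((x₁ - p.2) / a) * (starRingEnd ℂ) (f ((z₁ - p.2) / a)) *
        (((χ ((2 : ℝ) ^ (-(j : ℝ)) * h ^ (-(1 / ((k : ℝ) + 1))) * |p.1|)) ^ 2 : ℝ) : ℂ) *
        β (x₁, x₂, p.1) * (starRingEnd ℂ) (β (z₁, z₂, p.1))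

/-- First-derivative van der Corput estimate for a convex phase. -/
theorem norm_integral_exp_le_of_le_deriv {ψ ψ₁ ψ₂ : ℝ → ℝ}
    (h₁ : ∀ t, HasDerivAt ψ (ψ₁ t) t) (h₂ : ∀ t, HasDerivAt ψ₁ (ψ₂ t) t)
    (hc : Continuous ψ₂) {u v ν : ℝ} (huv : u ≤ v) (hν : 0 < ν)
    (hψ₁ : ∀ t ∈ Set.Icc u v, ν ≤ ψ₁ t) (hψ₂ : ∀ t ∈ Set.Icc u v, 0 ≤ ψ₂ t) :
    ‖∫ t in u..v, Complex.exp (Complex.I * (ψ t : ℂ))‖ ≤ 3 / ν := by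
  have hpos : ∀ t ∈ Set.Icc u v, 0 < ψ₁ t := fun t ht => hν.trans_le (hψ₁ t ht)
  have hcψ₁ : Continuous ψ₁ := continuous_iff_continuousAt.2 fun t => (h₂ t).continuousAt
  have hcψ : Continuous ψ := continuous_iff_continuousAt.2 fun t => (h₁ t).continuousAt
  have huIcc : Set.uIcc u v = Set.Icc u v := Set.uIcc_of_le huv
  have hnorm : ∀ t, ‖Complex.exp (Complex.I * (ψ t : ℂ))‖ = 1 := fun t => by
    rw [mul_comm]; exact Complex.norm_exp_ofReal_mul_I _
  have hE : ∀ t, HasDerivAt (fun t => -Complex.I * Complex.exp (Complex.I * (ψ t : ℂ)))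
      (Complex.exp (Complex.I * (ψ t : ℂ)) * (ψ₁ t : ℂ)) t := fun t => by
    refine ((((h₁ t).ofReal_comp.const_mul Complex.I).cexp).const_mul (-Complex.I)).congr_deriv ?_
    linear_combination (-Complex.exp (Complex.I * (ψ t : ℂ)) * (ψ₁ t : ℂ)) * Complex.I_mul_I
  have hinvR : ∀ t ∈ Set.Icc u v, HasDerivAt (fun t => (ψ₁ t)⁻¹) (-ψ₂ t / ψ₁ t ^ 2) t :=
    fun t ht => (h₂ t).inv (hpos t ht).ne'
  have hcq : ContinuousOn (fun t => -ψ₂ t / ψ₁ t ^ 2) (Set.uIcc u v) := by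
    rw [huIcc]
    exact hc.neg.continuousOn.div (hcψ₁.pow 2).continuousOn
      fun t ht => (pow_pos (hpos t ht) 2).ne'
  have hparts := intervalIntegral.integral_mul_deriv_eq_deriv_mul (a := u) (b := v)
    (u := fun t => (((ψ₁ t)⁻¹ : ℝ) : ℂ)) (u' := fun t => ((-ψ₂ t / ψ₁ t ^ 2 : ℝ) : ℂ))
    (v := fun t => -Complex.I * Complex.exp (Complex.I * (ψ t : ℂ)))
    (v' := fun t => Complex.exp (Complex.I * (ψ t : ℂ)) * (ψ₁ t : ℂ))
    (fun t ht => (hinvR t (huIcc ▸ ht)).ofReal_comp) (fun t _ => hE t)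
    (Complex.continuous_ofReal.comp_continuousOn hcq).intervalIntegrable
    (by apply Continuous.intervalIntegrable; fun_prop)
  have hint : ∫ t in u..v, Complex.exp (Complex.I * (ψ t : ℂ)) =
      ∫ t in u..v, (((ψ₁ t)⁻¹ : ℝ) : ℂ) * (Complex.exp (Complex.I * (ψ t : ℂ)) * (ψ₁ t : ℂ)) := by
    refine intervalIntegral.integral_congr fun t ht => ?_
    have := (hpos t (huIcc ▸ ht)).ne'
    have : (ψ₁ t : ℂ) ≠ 0 := by exact_mod_cast this
    simp only [Complex.ofReal_inv]
    field_simp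
  have hrem : ‖∫ t in u..v, ((-ψ₂ t / ψ₁ t ^ 2 : ℝ) : ℂ) *
      (-Complex.I * Complex.exp (Complex.I * (ψ t : ℂ)))‖ ≤ (ψ₁ u)⁻¹ - (ψ₁ v)⁻¹ := by
    have hftc := intervalIntegral.integral_eq_sub_of_hasDerivAt
      (fun t ht => hinvR t (huIcc ▸ ht)) hcq.intervalIntegrable
    rw [show (ψ₁ u)⁻¹ - (ψ₁ v)⁻¹ = ∫ t in u..v, -(-ψ₂ t / ψ₁ t ^ 2) by
      rw [intervalIntegral.integral_neg, hftc]; ring]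
    refine intervalIntegral.norm_integral_le_of_norm_le huv (ae_of_all _ fun t ht => ?_)
      hcq.neg.intervalIntegrable
    have h0 := hψ₂ t (Set.Ioc_subset_Icc_self ht)
    rw [norm_mul, norm_mul, hnorm, Complex.norm_real, norm_neg, Complex.norm_I, Real.norm_eq_abs,
      neg_div, abs_neg, abs_of_nonneg (by positivity)]
    simp
  have hbd : ∀ t ∈ Set.Icc u v, (ψ₁ t)⁻¹ ≤ ν⁻¹ := fun t ht => inv_anti₀ hν (hψ₁ t ht)
  have hbdy : ∀ t ∈ Set.Icc u v,
      ‖(((ψ₁ t)⁻¹ : ℝ) : ℂ) * (-Complex.I * Complex.exp (Complex.I * (ψ t : ℂ)))‖ ≤ (ψ₁ t)⁻¹ :=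
    fun t ht => by
      rw [norm_mul, norm_mul, hnorm, Complex.norm_real, norm_neg, Complex.norm_I,
        Real.norm_of_nonneg (inv_nonneg.2 (hpos t ht).le)]
      simp
  have hu := Set.left_mem_Icc.2 huv
  have hv := Set.right_mem_Icc.2 huv
  rw [hint, hparts]
  refine (norm_sub_le _ _).trans ?_
  have := norm_sub_le
    ((((ψ₁ v)⁻¹ : ℝ) : ℂ) * (-Complex.I * Complex.exp (Complex.I * (ψ v : ℂ))))
    ((((ψ₁ u)⁻¹ : ℝ) : ℂ) * (-Complex.I * Complex.exp (Complex.I * (ψ u : ℂ))))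
  have e : 3 / ν = 3 * ν⁻¹ := by ring
  have := hbd u hu
  have := hbdy u hu
  have := hbdy v hv
  have : 0 < ν⁻¹ := by positivity
  linarith

/-- Second-derivative van der Corput estimate to the right of a critical point. -/
theorem norm_integral_exp_le_of_deriv_left_nonneg {ψ ψ₁ ψ₂ : ℝ → ℝ}
    (h₁ : ∀ t, HasDerivAt ψ (ψ₁ t) t) (h₂ : ∀ t, HasDerivAt ψ₁ (ψ₂ t) t)
    (hc : Continuous ψ₂) {u v μ : ℝ} (huv : u ≤ v) (hμ : 0 < μ)
    (hu : 0 ≤ ψ₁ u) (hψ₂ : ∀ t ∈ Set.Icc u v, μ ≤ ψ₂ t) :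
    ‖∫ t in u..v, Complex.exp (Complex.I * (ψ t : ℂ))‖ ≤ 4 / √μ := by
  have hcψ : Continuous ψ := continuous_iff_continuousAt.2 fun t => (h₁ t).continuousAt
  have hs : 0 < √μ := Real.sqrt_pos.2 hμ
  have hss : √μ * √μ = μ := Real.mul_self_sqrt hμ.le
  have hint : ∀ p q, IntervalIntegrable (fun t => Complex.exp (Complex.I * (ψ t : ℂ)))
      volume p q := fun p q => by apply Continuous.intervalIntegrable; fun_prop
  have htriv : ∀ p q, ‖∫ t in p..q, Complex.exp (Complex.I * (ψ t : ℂ))‖ ≤ 1 * |q - p| :=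
    fun p q => intervalIntegral.norm_integral_le_of_norm_le_const fun t _ => by
      rw [mul_comm, Complex.norm_exp_ofReal_mul_I]
  have hδ : 0 < (√μ)⁻¹ := by positivity
  have e : 4 / √μ = 4 * (√μ)⁻¹ := by ring
  rcases le_total v (u + (√μ)⁻¹) with hv | hv
  · refine (htriv u v).trans ?_
    rw [abs_of_nonneg (by linarith)]
    linarith
  · have hmvt : ∀ t ∈ Set.Icc u v, μ * (t - u) ≤ ψ₁ t := fun t ht => by
      have := (convex_Icc u v).mul_sub_le_image_sub_of_le_deriv
        (fun s _ => (h₂ s).continuousAt.continuousWithinAt)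
        (fun s _ => (h₂ s).differentiableAt.differentiableWithinAt)
        (fun s hs => by rw [(h₂ s).deriv]; exact hψ₂ s (interior_subset hs))
        u (Set.left_mem_Icc.2 huv) t ht ht.1
      linarith
    have hfar := norm_integral_exp_le_of_le_deriv h₁ h₂ hc hv hs
      (fun t ht => by
        have := hmvt t ⟨by linarith [ht.1], ht.2⟩
        have h3 : μ * (√μ)⁻¹ ≤ μ * (t - u) := by
          gcongr; linarith [ht.1]
        have h4 : μ * (√μ)⁻¹ = √μ := by
          nth_rewrite 1 [← hss]; field_simp
        linarith)
      (fun t ht => hμ.le.trans (hψ₂ t ⟨by linarith [ht.1], ht.2⟩))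
    have hnear := htriv u (u + (√μ)⁻¹)
    rw [abs_of_nonneg (by linarith)] at hnear
    rw [← intervalIntegral.integral_add_adjacent_intervals (hint u (u + (√μ)⁻¹)) (hint _ v)]
    refine (norm_add_le _ _).trans ?_
    have e3 : 3 / √μ = 3 * (√μ)⁻¹ := by ring
    linarith

/-- Second-derivative van der Corput estimate for a uniformly convex phase. -/
theorem norm_integral_exp_le_of_le_second_deriv {ψ ψ₁ ψ₂ : ℝ → ℝ}
    (h₁ : ∀ t, HasDerivAt ψ (ψ₁ t) t) (h₂ : ∀ t, HasDerivAt ψ₁ (ψ₂ t) t)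
    (hc : Continuous ψ₂) {u v μ : ℝ} (huv : u ≤ v) (hμ : 0 < μ)
    (hψ₂ : ∀ t ∈ Set.Icc u v, μ ≤ ψ₂ t) :
    ‖∫ t in u..v, Complex.exp (Complex.I * (ψ t : ℂ))‖ ≤ 8 / √μ := by
  have hcψ : Continuous ψ := continuous_iff_continuousAt.2 fun t => (h₁ t).continuousAt
  have hcψ₁ : Continuous ψ₁ := continuous_iff_continuousAt.2 fun t => (h₂ t).continuousAt
  have hint : ∀ p q, IntervalIntegrable (fun t => Complex.exp (Complex.I * (ψ t : ℂ)))
      volume p q := fun p q => by apply Continuous.intervalIntegrable; fun_prop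
  have hleft : ∀ w ∈ Set.Icc u v, ψ₁ w ≤ 0 →
      ‖∫ t in u..w, Complex.exp (Complex.I * (ψ t : ℂ))‖ ≤ 4 / √μ := fun w hw hw0 => by
    have := norm_integral_exp_le_of_deriv_left_nonneg (ψ := fun t => ψ (-t))
      (ψ₁ := fun t => -ψ₁ (-t)) (ψ₂ := fun t => ψ₂ (-t)) (u := -w) (v := -u)
      (fun t => ((h₁ (-t)).scomp t (hasDerivAt_neg t)).congr_deriv (by simp))
      (fun t => ((h₂ (-t)).scomp t (hasDerivAt_neg t)).neg.congr_deriv (by simp))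
      (hc.comp continuous_neg) (by linarith [hw.1]) hμ (by simpa using hw0)
      (fun t ht => hψ₂ _ ⟨by linarith [ht.2], by linarith [ht.1, hw.2]⟩)
    rwa [intervalIntegral.integral_comp_neg (fun t => Complex.exp (Complex.I * (ψ t : ℂ))),
      neg_neg, neg_neg] at this
  have hright : ∀ w ∈ Set.Icc u v, 0 ≤ ψ₁ w →
      ‖∫ t in w..v, Complex.exp (Complex.I * (ψ t : ℂ))‖ ≤ 4 / √μ := fun w hw hw0 =>
    norm_integral_exp_le_of_deriv_left_nonneg h₁ h₂ hc hw.2 hμ hw0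
      fun t ht => hψ₂ t ⟨hw.1.trans ht.1, ht.2⟩
  have hle : 4 / √μ + 4 / √μ = 8 / √μ := by ring
  have h4 : 0 ≤ 4 / √μ := by positivity
  rcases le_total 0 (ψ₁ u) with hu | hu
  · linarith [hright u (Set.left_mem_Icc.2 huv) hu]
  rcases le_total (ψ₁ v) 0 with hv | hv
  · linarith [hleft v (Set.right_mem_Icc.2 huv) hv]
  obtain ⟨w, hw, hw0⟩ := intermediate_value_Icc huv hcψ₁.continuousOn ⟨hu, hv⟩
  rw [← intervalIntegral.integral_add_adjacent_intervals (hint u w) (hint w v), ← hle]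
  exact (norm_add_le _ _).trans (add_le_add (hleft w hw hw0.le) (hright w hw hw0.ge))

/-- Second-derivative van der Corput estimate. -/
theorem norm_integral_exp_le_of_le_abs_second_deriv {ψ ψ₁ ψ₂ : ℝ → ℝ}
    (h₁ : ∀ t, HasDerivAt ψ (ψ₁ t) t) (h₂ : ∀ t, HasDerivAt ψ₁ (ψ₂ t) t)
    (hc : Continuous ψ₂) {u v μ : ℝ} (huv : u ≤ v) (hμ : 0 < μ)
    (hψ₂ : ∀ t ∈ Set.Icc u v, μ ≤ |ψ₂ t|) :
    ‖∫ t in u..v, Complex.exp (Complex.I * (ψ t : ℂ))‖ ≤ 8 / √μ := by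
  by_cases hpos : ∀ t ∈ Set.Icc u v, 0 ≤ ψ₂ t
  · exact norm_integral_exp_le_of_le_second_deriv h₁ h₂ hc huv hμ
      fun t ht => by rw [← abs_of_nonneg (hpos t ht)]; exact hψ₂ t ht
  have hneg : ∀ t ∈ Set.Icc u v, ψ₂ t ≤ 0 := by
    by_contra! hex
    push Not at hpos
    obtain ⟨p, hp, hp0⟩ := hpos
    obtain ⟨q, hq, hq0⟩ := hex
    obtain ⟨w, hw, hw0⟩ := isPreconnected_Icc.intermediate_value hp hq hc.continuousOn
      ⟨hp0.le, hq0.le⟩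
    have := hψ₂ w hw
    rw [hw0, abs_zero] at this
    linarith
  have := norm_integral_exp_le_of_le_second_deriv (fun t => (h₁ t).neg) (fun t => (h₂ t).neg)
    hc.neg huv hμ fun t ht => by
      have := hψ₂ t ht
      rwa [abs_of_nonpos (hneg t ht)] at this
  rw [intervalIntegral.integral_of_le huv] at this ⊢
  rw [← RCLike.norm_conj, ← integral_conj]
  refine le_of_eq_of_le (congrArg _ (integral_congr_ae (ae_of_all _ fun t => ?_))) this
  simp [← Complex.exp_conj]

/-- Van der Corput estimate with an amplitude vanishing at the endpoints. -/
theorem norm_integral_exp_mul_le {ψ ψ₁ ψ₂ : ℝ → ℝ}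
    (h₁ : ∀ t, HasDerivAt ψ (ψ₁ t) t) (h₂ : ∀ t, HasDerivAt ψ₁ (ψ₂ t) t)
    (hc : Continuous ψ₂) {u v μ : ℝ} (huv : u ≤ v) (hμ : 0 < μ)
    (hψ₂ : ∀ t ∈ Set.Icc u v, μ ≤ |ψ₂ t|) {g g' : ℝ → ℂ}
    (hg : ∀ t, HasDerivAt g (g' t) t) (hg' : Continuous g') (hgv : g v = 0)
    {K : ℝ} (hK : ∀ t, ‖g' t‖ ≤ K) :
    ‖∫ t in u..v, Complex.exp (Complex.I * (ψ t : ℂ)) * g t‖ ≤ 8 / √μ * K * (v - u) := by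
  have hcψ : Continuous ψ := continuous_iff_continuousAt.2 fun t => (h₁ t).continuousAt
  have hcE : Continuous fun t => Complex.exp (Complex.I * (ψ t : ℂ)) := by fun_prop
  have hparts := intervalIntegral.integral_mul_deriv_eq_deriv_mul (a := u) (b := v)
    (u := g) (u' := g') (v := fun s => ∫ t in u..s, Complex.exp (Complex.I * (ψ t : ℂ)))
    (v' := fun t => Complex.exp (Complex.I * (ψ t : ℂ)))
    (fun t _ => hg t) (fun t _ => hcE.integral_hasStrictDerivAt u t |>.hasDerivAt)
    (hg'.intervalIntegrable _ _) (hcE.intervalIntegrable _ _)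
  simp only [mul_comm _ (g _), hparts, hgv, zero_mul, intervalIntegral.integral_same, mul_zero,
    sub_zero, zero_sub, norm_neg]
  rw [← abs_of_nonneg (sub_nonneg.2 huv)]
  refine intervalIntegral.norm_integral_le_of_norm_le_const fun t ht => ?_
  rw [Set.uIoc_of_le huv] at ht
  rw [norm_mul, mul_comm]
  gcongr
  · exact norm_integral_exp_le_of_le_abs_second_deriv h₁ h₂ hc ht.1.le hμ
      fun s hs => hψ₂ s ⟨hs.1, hs.2.trans ht.2⟩
  · exact hK t

/-- The square of an even dyadic cutoff is a smooth bump adapted to `|t| ≤ 2`. -/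
theorem exists_bound_deriv_cutoff {χ : ℝ → ℝ} (hχ : ContDiff ℝ (⊤ : ℕ∞) χ)
    (hχs : tsupport χ ⊆ Set.Icc (1 / 2 : ℝ) (3 / 2)) :
    (∀ t, 2 ≤ |t| → χ |t| ^ 2 = 0) ∧ ContDiff ℝ 1 (fun t => χ |t| ^ 2) ∧
      ∃ K, 0 < K ∧ ∀ t, |deriv (fun t => χ |t| ^ 2) t| ≤ K := by
  have hzero : ∀ t, t < 1 / 2 ∨ 3 / 2 < t → χ t = 0 := fun t ht => by
    refine image_eq_zero_of_notMem_tsupport fun hmem => ?_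
    have := hχs hmem
    rcases ht with ht | ht <;> linarith [this.1, this.2]
  have hfar : ∀ t, 2 ≤ |t| → χ |t| ^ 2 = 0 := fun t ht => by
    rw [hzero _ (Or.inr (by linarith))]; simp
  have heq : (fun t => χ |t| ^ 2) = fun t => χ t ^ 2 + χ (-t) ^ 2 := by
    funext t
    rcases le_total 0 t with ht | ht
    · rw [abs_of_nonneg ht, hzero (-t) (Or.inl (by linarith))]; simp
    · rw [abs_of_nonpos ht, hzero t (Or.inl (by linarith))]; simp
  have hsm : ContDiff ℝ 1 (fun t => χ |t| ^ 2) := by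
    rw [heq]
    have hχ' : ContDiff ℝ 1 χ := hχ.of_le (by exact_mod_cast le_top)
    exact (hχ'.pow 2).add ((hχ'.comp contDiff_neg).pow 2)
  have hcs : HasCompactSupport (fun t => χ |t| ^ 2) :=
    HasCompactSupport.intro (isCompact_Icc (a := (-2 : ℝ)) (b := 2)) fun t ht => by
      refine hfar t ?_
      by_contra! hlt
      exact ht ⟨(abs_lt.1 hlt).1.le, (abs_lt.1 hlt).2.le⟩
  obtain ⟨K, hK⟩ := hcs.deriv.exists_bound_of_continuous (hsm.continuous_deriv le_rfl)
  exact ⟨hfar, hsm, max K 1, by positivity, fun t => (hK t).trans (le_max_left _ _)⟩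

/-- A smooth compactly supported function is bounded together with its derivative. -/
theorem exists_bound_and_bound_fderiv {E F : Type*} [NormedAddCommGroup E] [NormedSpace ℝ E]
    [NormedAddCommGroup F] [NormedSpace ℝ F] {β : E → F} (hβ : ContDiff ℝ (⊤ : ℕ∞) β)
    (hβc : HasCompactSupport β) :
    ∃ M, 0 < M ∧ (∀ p, ‖β p‖ ≤ M) ∧ ∀ p, ‖fderiv ℝ β p‖ ≤ M := by
  obtain ⟨M₁, h₁⟩ := hβc.exists_bound_of_continuous hβ.continuous
  obtain ⟨M₂, h₂⟩ := (hβc.fderiv (𝕜 := ℝ)).exists_bound_of_continuous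
    (hβ.continuous_fderiv (by simp))
  refine ⟨max (max M₁ M₂) 1, by positivity, fun p => (h₁ p).trans ?_, fun p => (h₂ p).trans ?_⟩
  · exact (le_max_left _ _).trans (le_max_left _ _)
  · exact (le_max_right _ _).trans (le_max_left _ _)

/-- The `b`-integral in the kernel is `O(a)`. -/
theorem exists_norm_integral_mul_conj_le {f : ℝ → ℂ} (hf : Continuous f)
    (hfc : HasCompactSupport f) :
    ∃ D, 0 < D ∧ ∀ a, 0 < a → ∀ x z : ℝ,
      ‖∫ b, f ((x - b) / a) * (starRingEnd ℂ) (f ((z - b) / a))‖ ≤ D * a := by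
  obtain ⟨M, hM⟩ := hfc.exists_bound_of_continuous hf
  have hint : Integrable f := hf.integrable_of_hasCompactSupport hfc
  have hM' : 0 ≤ M := (norm_nonneg _).trans (hM 0)
  have hN : 0 ≤ ∫ t, ‖f t‖ := integral_nonneg fun t => norm_nonneg _
  refine ⟨M * (∫ t, ‖f t‖) + 1, by positivity, fun a ha x z => ?_⟩
  have hcov : ∫ b, ‖f ((x - b) / a)‖ = a * ∫ t, ‖f t‖ := by
    rw [integral_sub_left_eq_self (fun b => ‖f (b / a)‖) volume x,
      Measure.integral_comp_div (fun t => ‖f t‖) a, abs_of_pos ha, smul_eq_mul]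
  have hI : Integrable fun b => ‖f ((x - b) / a)‖ :=
    ((hint.norm.comp_div ha.ne').comp_sub_left x)
  calc _ ≤ ∫ b, ‖f ((x - b) / a)‖ * M := by
        refine norm_integral_le_of_norm_le (hI.mul_const M) (ae_of_all _ fun b => ?_)
        rw [norm_mul, RCLike.norm_conj]
        gcongr
        exact hM _
    _ = M * (∫ t, ‖f t‖) * a := by rw [integral_mul_const, hcov]; ring
    _ ≤ _ := by gcongr; linarith

/-- Uniform bounds for the `ξ₂`-amplitude of the kernel at dyadic scale `L`. -/
theorem exists_amplitude_bounds {β : ℝ × ℝ × ℝ → ℂ} (hβ : ContDiff ℝ (⊤ : ℕ∞) β)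
    (hβc : HasCompactSupport β) {χ : ℝ → ℝ} (hχ : ContDiff ℝ (⊤ : ℕ∞) χ)
    (hχ0 : ∀ t, 0 ≤ χ t) (hχ1 : ∀ t, χ t ≤ 1)
    (hχs : tsupport χ ⊆ Set.Icc (1 / 2 : ℝ) (3 / 2)) :
    ∃ K, 0 < K ∧ ∀ L, 0 < L → L ≤ 1 → ∀ x₁ x₂ z₁ z₂ : ℝ, ∃ g' : ℝ → ℂ,
      (∀ t, HasDerivAt (fun ξ => ((χ |L⁻¹ * ξ| ^ 2 : ℝ) : ℂ) *
        (β (x₁, x₂, ξ) * (starRingEnd ℂ) (β (z₁, z₂, ξ)))) (g' t) t) ∧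
      Continuous g' ∧ (∀ t, ‖g' t‖ ≤ K / L) ∧
      ∀ t, ‖((χ |L⁻¹ * t| ^ 2 : ℝ) : ℂ) *
        (β (x₁, x₂, t) * (starRingEnd ℂ) (β (z₁, z₂, t)))‖ ≤ K := by
  obtain ⟨-, hsm, K₀, hK₀, hK₀'⟩ := exists_bound_deriv_cutoff hχ hχs
  obtain ⟨M, hM, hMβ, hMβ'⟩ := exists_bound_and_bound_fderiv hβ hβc
  set η : ℝ → ℝ := fun t => χ |t| ^ 2 with hη
  have hη1 : ∀ t, |η t| ≤ 1 := fun t => by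
    rw [abs_of_nonneg (sq_nonneg _)]
    exact pow_le_one₀ (hχ0 _) (hχ1 _)
  have hcη : Continuous (deriv η) := hsm.continuous_deriv le_rfl
  have hcβ : Continuous (fderiv ℝ β) := hβ.continuous_fderiv (by simp)
  have hcβ0 : Continuous β := hβ.continuous
  have hcη0 : Continuous η := hsm.continuous
  have hdβ : ∀ x₁ x₂ t : ℝ,
      HasDerivAt (fun ξ => β (x₁, x₂, ξ)) (fderiv ℝ β (x₁, x₂, t) (0, 0, 1)) t := fun x₁ x₂ t =>
    ((hβ.differentiable (by simp)) _).hasFDerivAt.comp_hasDerivAt t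
      ((hasDerivAt_const t x₁).prodMk ((hasDerivAt_const t x₂).prodMk (hasDerivAt_id t)))
  have hbβ : ∀ x₁ x₂ t : ℝ, ‖fderiv ℝ β (x₁, x₂, t) (0, 0, 1)‖ ≤ M := fun x₁ x₂ t => by
    refine ((fderiv ℝ β (x₁, x₂, t)).le_opNorm _).trans ?_
    have : ‖((0, 0, 1) : ℝ × ℝ × ℝ)‖ = 1 := by simp [Prod.norm_def]
    rw [this, mul_one]
    exact hMβ' _
  refine ⟨K₀ * M ^ 2 + 2 * M ^ 2, by positivity, fun L hL hL1 x₁ x₂ z₁ z₂ => ?_⟩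
  refine ⟨fun t => ((deriv η (L⁻¹ * t) * L⁻¹ : ℝ) : ℂ) *
      (β (x₁, x₂, t) * (starRingEnd ℂ) (β (z₁, z₂, t))) + ((η (L⁻¹ * t) : ℝ) : ℂ) *
      (fderiv ℝ β (x₁, x₂, t) (0, 0, 1) * (starRingEnd ℂ) (β (z₁, z₂, t)) +
        β (x₁, x₂, t) * (starRingEnd ℂ) (fderiv ℝ β (z₁, z₂, t) (0, 0, 1))),
    fun t => ?_, ?_, fun t => ?_, fun t => ?_⟩
  · have h1 : HasDerivAt (fun ξ => η (L⁻¹ * ξ)) (deriv η (L⁻¹ * t) * L⁻¹) t :=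
      ((hsm.differentiable one_ne_zero _).hasDerivAt.comp t
        ((hasDerivAt_id t).const_mul L⁻¹)).congr_deriv (by simp)
    exact h1.ofReal_comp.mul ((hdβ x₁ x₂ t).mul (hdβ z₁ z₂ t).star)
  · have : ∀ x₁ x₂ : ℝ, Continuous fun t : ℝ => fderiv ℝ β (x₁, x₂, t) (0, 0, 1) :=
      fun x₁ x₂ => (hcβ.comp (by fun_prop)).clm_apply continuous_const
    have h1 := this x₁ x₂
    have h2 := Complex.continuous_conj.comp (this z₁ z₂)
    have h3 := Complex.continuous_conj.comp
      (hcβ0.comp (by fun_prop : Continuous fun t : ℝ => (z₁, z₂, t)))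
    simp only [Function.comp_def] at h2 h3
    fun_prop
  · have hLinv : 1 ≤ L⁻¹ := (one_le_inv₀ hL).2 hL1
    calc _ ≤ K₀ * L⁻¹ * (M * M) + 1 * (M * M + M * M) := by
          refine (norm_add_le _ _).trans (add_le_add ?_ ?_)
          · rw [norm_mul, norm_mul, RCLike.norm_conj, Complex.norm_real, norm_mul,
              Real.norm_of_nonneg (inv_nonneg.2 hL.le)]
            gcongr
            · exact hK₀' _
            · exact hMβ _
            · exact hMβ _
          · rw [norm_mul, Complex.norm_real]
            refine mul_le_mul (hη1 _) ((norm_add_le _ _).trans (add_le_add ?_ ?_))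
              (norm_nonneg _) zero_le_one
            all_goals
              rw [norm_mul, RCLike.norm_conj]
              gcongr
              all_goals first | exact hMβ _ | exact hbβ _ _ _
      _ ≤ (K₀ * M ^ 2 + 2 * M ^ 2) / L := by
          rw [div_eq_mul_inv]
          nlinarith [mul_le_mul_of_nonneg_left hLinv (by positivity : 0 ≤ 2 * M ^ 2)]
  · calc _ ≤ 1 * (M * M) := by
          rw [norm_mul, norm_mul, RCLike.norm_conj, Complex.norm_real]
          gcongr
          · exact hη1 _
          · exact hMβ _
          · exact hMβ _
      _ ≤ _ := by nlinarith [mul_pos hK₀ (pow_pos hM 2), pow_pos hM 2]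

/-- The `ξ₂`-integral in the kernel: trivial and van der Corput bounds at dyadic scale `L`. -/
theorem exists_norm_frequency_integral_le
    {φ : ℝ × ℝ × ℝ → ℝ} (hφ : ContDiff ℝ (⊤ : ℕ∞) φ)
    {β : ℝ × ℝ × ℝ → ℂ} (hβ : ContDiff ℝ (⊤ : ℕ∞) β) (hβc : HasCompactSupport β)
    {χ : ℝ → ℝ} (hχ : ContDiff ℝ (⊤ : ℕ∞) χ)
    (hχ0 : ∀ t, 0 ≤ χ t) (hχ1 : ∀ t, χ t ≤ 1)
    (hχs : tsupport χ ⊆ Set.Icc (1 / 2 : ℝ) (3 / 2))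
    {A B : ℝ} (hAB : A < B)
    (hIβ : closure {ξ₂ : ℝ | ∃ x₁ x₂, (x₁, x₂, ξ₂) ∈ tsupport β} ⊆ Set.Ioo A B)
    {c : ℝ} (hc : 0 < c)
    (hcurv : ∀ x₁ x₂ z₁ z₂ : ℝ,
      (∃ ξ₂, (x₁, x₂, ξ₂) ∈ tsupport β) → (∃ ξ₂', (z₁, z₂, ξ₂') ∈ tsupport β) →
      ∀ ζ ∈ Set.Ioo A B, c * |x₁ - z₁| ≤
        |iteratedDeriv 2 (fun t => φ (x₁, x₂, t) - φ (z₁, z₂, t)) ζ|) :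
    ∃ K, 0 < K ∧ ∀ h, 0 < h → ∀ L, 0 < L → L ≤ 1 → ∀ x₁ x₂ z₁ z₂ : ℝ,
      ‖∫ ξ, Complex.exp (Complex.I * (((φ (x₁, x₂, ξ) - φ (z₁, z₂, ξ)) / h : ℝ) : ℂ)) *
        (((χ |L⁻¹ * ξ| ^ 2 : ℝ) : ℂ) *
          (β (x₁, x₂, ξ) * (starRingEnd ℂ) (β (z₁, z₂, ξ))))‖ ≤ K * L ∧
      (x₁ ≠ z₁ →
      ‖∫ ξ, Complex.exp (Complex.I * (((φ (x₁, x₂, ξ) - φ (z₁, z₂, ξ)) / h : ℝ) : ℂ)) *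
        (((χ |L⁻¹ * ξ| ^ 2 : ℝ) : ℂ) *
          (β (x₁, x₂, ξ) * (starRingEnd ℂ) (β (z₁, z₂, ξ))))‖ ≤ K * (√h / √|x₁ - z₁|)) := by
  obtain ⟨hfar, -⟩ := exists_bound_deriv_cutoff hχ hχs
  obtain ⟨K, hK, hamp⟩ := exists_amplitude_bounds hβ hβc hχ hχ0 hχ1 hχs
  have hsc : 0 < √c := Real.sqrt_pos.2 hc
  refine ⟨max (4 * K) (32 * K / √c), by positivity, fun h hh L hL hL1 x₁ x₂ z₁ z₂ => ?_⟩
  obtain ⟨g', hg, hg', hKg', hKg⟩ := hamp L hL hL1 x₁ x₂ z₁ z₂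
  set g : ℝ → ℂ := fun ξ => ((χ |L⁻¹ * ξ| ^ 2 : ℝ) : ℂ) *
        (β (x₁, x₂, ξ) * (starRingEnd ℂ) (β (z₁, z₂, ξ))) with hgdef
  set Ψ : ℝ → ℝ := fun t => φ (x₁, x₂, t) - φ (z₁, z₂, t) with hΨ
  change ‖∫ ξ, Complex.exp (Complex.I * ((Ψ ξ / h : ℝ) : ℂ)) * g ξ‖ ≤ _ ∧
    (_ → ‖∫ ξ, Complex.exp (Complex.I * ((Ψ ξ / h : ℝ) : ℂ)) * g ξ‖ ≤ _)
  have hgβ : ∀ t, t ∉ Set.Ioo A B → g t = 0 := fun t ht => by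
    have : β (x₁, x₂, t) = 0 := image_eq_zero_of_notMem_tsupport fun hmem =>
      ht (hIβ (subset_closure ⟨x₁, x₂, hmem⟩))
    simp [hgdef, this]
  have hgχ : ∀ t, 2 * L ≤ |t| → g t = 0 := fun t ht => by
    have : χ |L⁻¹ * t| ^ 2 = 0 := hfar _ (by
      rw [abs_mul, abs_of_pos (inv_pos.2 hL), inv_mul_eq_div, le_div_iff₀ hL]; exact ht)
    simp only [hgdef, this]; simp
  set u := max A (-(2 * L)) with hu
  set v := min B (2 * L) with hv
  have hgu : ∀ t, t ≤ u → g t = 0 := fun t ht => by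
    rcases le_max_iff.1 ht with h | h
    · exact hgβ t fun hm => absurd hm.1 h.not_gt
    · exact hgχ t (le_trans (by linarith) (neg_le_abs t))
  have hgv : ∀ t, v ≤ t → g t = 0 := fun t ht => by
    rcases min_le_iff.1 ht with h | h
    · exact hgβ t fun hm => absurd hm.2 h.not_gt
    · exact hgχ t (h.trans (le_abs_self t))
  rcases le_or_gt v u with hvu | huv
  · have hg0 : ∀ t, g t = 0 := fun t =>
      (le_total t u).elim (hgu t) fun ht => hgv t (hvu.trans ht)
    simp only [hg0, mul_zero, integral_zero, norm_zero]
    exact ⟨by positivity, fun _ => by positivity⟩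
  have hlen : v - u ≤ 4 * L := by
    linarith [le_max_right A (-(2 * L)), min_le_right B (2 * L)]
  have hloc : ∫ ξ, Complex.exp (Complex.I * ((Ψ ξ / h : ℝ) : ℂ)) * g ξ =
      ∫ ξ in u..v, Complex.exp (Complex.I * ((Ψ ξ / h : ℝ) : ℂ)) * g ξ := by
    rw [intervalIntegral.integral_of_le huv.le]
    refine (setIntegral_eq_integral_of_forall_compl_eq_zero fun t ht => ?_).symm
    have : g t = 0 := by
      by_contra hne
      exact ht ⟨lt_of_not_ge fun h => hne (hgu t h), (lt_of_not_ge fun h => hne (hgv t h)).le⟩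
    rw [this, mul_zero]
  rw [hloc]
  constructor
  · calc _ ≤ K * |v - u| := intervalIntegral.norm_integral_le_of_norm_le_const fun t _ => by
          rw [norm_mul, mul_comm Complex.I, Complex.norm_exp_ofReal_mul_I, one_mul]
          exact hKg t
      _ ≤ K * (4 * L) := by rw [abs_of_pos (sub_pos.2 huv)]; gcongr
      _ = (4 * K) * L := by ring
      _ ≤ _ := by gcongr; exact le_max_left _ _
  intro hne
  have hd : 0 < |x₁ - z₁| := abs_pos.2 (sub_ne_zero.2 hne)
  by_cases hx : ∃ ξ, (x₁, x₂, ξ) ∈ tsupport β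
  swap
  · have hg0 : ∀ t, g t = 0 := fun t => by
      have : β (x₁, x₂, t) = 0 := image_eq_zero_of_notMem_tsupport fun hmem => hx ⟨t, hmem⟩
      simp [hgdef, this]
    simp only [hg0, mul_zero, intervalIntegral.integral_zero, norm_zero]
    positivity
  by_cases hz : ∃ ξ, (z₁, z₂, ξ) ∈ tsupport β
  swap
  · have hg0 : ∀ t, g t = 0 := fun t => by
      have : β (z₁, z₂, t) = 0 := image_eq_zero_of_notMem_tsupport fun hmem => hz ⟨t, hmem⟩
      simp [hgdef, this]
    simp only [hg0, mul_zero, intervalIntegral.integral_zero, norm_zero]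
    positivity
  have hΨs : ContDiff ℝ (⊤ : ℕ∞) Ψ :=
    (hφ.comp (by fun_prop)).sub (hφ.comp (by fun_prop))
  have hΨ1 : ∀ t, HasDerivAt Ψ (deriv Ψ t) t := fun t =>
    (hΨs.differentiable (by simp) t).hasDerivAt
  have hΨd : ∀ m : ℕ, Differentiable ℝ (iteratedDeriv m Ψ) := fun m =>
    hΨs.differentiable_iteratedDeriv m (by exact_mod_cast ENat.natCast_lt_top m)
  have hΨ2 : ∀ t, HasDerivAt (deriv Ψ) (iteratedDeriv 2 Ψ t) t := fun t => by
    have hd1 := hΨd 1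
    rw [iteratedDeriv_one] at hd1
    rw [iteratedDeriv_succ, iteratedDeriv_one]
    exact (hd1 t).hasDerivAt
  have hΨc : Continuous (iteratedDeriv 2 Ψ) := (hΨd 2).continuous
  have hcurv' : ∀ t ∈ Set.Icc A B, c * |x₁ - z₁| ≤ |iteratedDeriv 2 Ψ t| := by
    rw [← closure_Ioo hAB.ne]
    exact fun t ht => le_on_closure (hcurv x₁ x₂ z₁ z₂ hx hz) continuousOn_const
      hΨc.abs.continuousOn ht
  have hvdc := norm_integral_exp_mul_le (ψ := fun t => Ψ t / h)
    (fun t => (hΨ1 t).div_const h) (fun t => (hΨ2 t).div_const h) (hΨc.div_const h) huv.le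
    (μ := c * |x₁ - z₁| / h) (by positivity)
    (fun t ht => by
      rw [abs_div, abs_of_pos hh]
      gcongr
      exact hcurv' t ⟨(le_max_left _ _).trans ht.1, ht.2.trans (min_le_left _ _)⟩)
    hg hg' (hgv v le_rfl) hKg'
  refine hvdc.trans ?_
  have hsh : 0 < √h := Real.sqrt_pos.2 hh
  have hsd : 0 < √|x₁ - z₁| := Real.sqrt_pos.2 hd
  calc _ ≤ 8 / √(c * |x₁ - z₁| / h) * (K / L) * (4 * L) := by gcongr
    _ = 32 * K / √c * (√h / √|x₁ - z₁|) := by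
        rw [Real.sqrt_div (by positivity), Real.sqrt_mul hc.le]
        field_simp
        ring
    _ ≤ _ := by gcongr; exact le_max_right _ _

/-- Pointwise bounds on the kernel `K_j`:
`|K_j| ≲ a 2^j h^{-1+1/(k+1)}` for `|x₁-z₁| ≤ 2^{-2j} h^{1-2/(k+1)}` and
`|K_j| ≲ a h^{-1/2} |x₁-z₁|^{-1/2}` for `|x₁-z₁| ≥ 2^{-2j} h^{1-2/(k+1)}`. -/
theorem Kj_kernel_bounds
    (k : ℕ) (hk : 1 ≤ k)
    (φ : ℝ × ℝ × ℝ → ℝ) (hφ : ContDiff ℝ (⊤ : ℕ∞) φ)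
    (β : ℝ × ℝ × ℝ → ℂ) (hβ : ContDiff ℝ (⊤ : ℕ∞) β) (hβc : HasCompactSupport β)
    (f : ℝ → ℂ) (hf : ContDiff ℝ (⊤ : ℕ∞) f) (hfc : HasCompactSupport f)
    (χ : ℝ → ℝ) (hχ : ContDiff ℝ (⊤ : ℕ∞) χ)
    (hχ0 : ∀ t, 0 ≤ χ t) (hχ1 : ∀ t, χ t ≤ 1)
    (hχs : tsupport χ ⊆ Set.Icc (1 / 2 : ℝ) (3 / 2))
    (A B : ℝ) (hAB : A < B)
    (hIβ : closure {ξ₂ : ℝ | ∃ x₁ x₂, (x₁, x₂, ξ₂) ∈ tsupport β} ⊆ Set.Ioo A B)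
    -- curvature hypothesis
    (c : ℝ) (hc : 0 < c) (Cm : ℕ → ℝ)
    (hcurv : ∀ x₁ x₂ z₁ z₂ : ℝ,
      (∃ ξ₂, (x₁, x₂, ξ₂) ∈ tsupport β) → (∃ ξ₂', (z₁, z₂, ξ₂') ∈ tsupport β) →
      ∀ ζ ∈ Set.Ioo A B,
        c * |x₁ - z₁| ≤
            |iteratedDeriv 2 (fun t => φ (x₁, x₂, t) - φ (z₁, z₂, t)) ζ| ∧
          ∀ m : ℕ, 2 ≤ m →
            |iteratedDeriv m (fun t => φ (x₁, x₂, t) - φ (z₁, z₂, t)) ζ| ≤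
              Cm m * |x₁ - z₁|) :
    ∃ C : ℝ, 0 < C ∧
      ∀ h : ℝ, 0 < h → h ≤ 1 →
      ∀ j : ℕ, 1 ≤ j → (2 : ℝ) ^ (j : ℝ) * h ^ (1 / ((k : ℝ) + 1)) ≤ 1 →
      ∀ a : ℝ, 0 < a →
      ∀ x₁ x₂ z₁ z₂ : ℝ,
        (|x₁ - z₁| ≤ (2 : ℝ) ^ (-(2 * (j : ℝ))) * h ^ (1 - 2 / ((k : ℝ) + 1)) →
          ‖Kj h a j k φ β f χ x₁ x₂ z₁ z₂‖ ≤
            C * a * (2 : ℝ) ^ (j : ℝ) * h ^ (-1 + 1 / ((k : ℝ) + 1))) ∧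
        ((2 : ℝ) ^ (-(2 * (j : ℝ))) * h ^ (1 - 2 / ((k : ℝ) + 1)) ≤ |x₁ - z₁| →
          ‖Kj h a j k φ β f χ x₁ x₂ z₁ z₂‖ ≤
            C * a * h ^ (-(1 : ℝ) / 2) * |x₁ - z₁| ^ (-(1 : ℝ) / 2)) := by
  obtain ⟨D, hD, hDb⟩ := exists_norm_integral_mul_conj_le hf.continuous hfc
  obtain ⟨K, hK, hKb⟩ := exists_norm_frequency_integral_le hφ hβ hβc hχ hχ0 hχ1 hχs hAB hIβ hc
    fun x₁ x₂ z₁ z₂ hx hz ζ hζ => (hcurv x₁ x₂ z₁ z₂ hx hz ζ hζ).1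
  refine ⟨D * K, by positivity, fun h hh _ j _ hjh a ha x₁ x₂ z₁ z₂ => ?_⟩
  set L : ℝ := (2 : ℝ) ^ (j : ℝ) * h ^ (1 / ((k : ℝ) + 1)) with hLdef
  have hL : 0 < L := by positivity
  have hLinv : (2 : ℝ) ^ (-(j : ℝ)) * h ^ (-(1 / ((k : ℝ) + 1))) = L⁻¹ := by
    rw [hLdef, mul_inv, Real.rpow_neg zero_le_two, Real.rpow_neg hh.le]
  obtain ⟨htriv, hvdc⟩ := hKb h hh L hL hjh x₁ x₂ z₁ z₂
  set J := ∫ ξ, Complex.exp (Complex.I * (((φ (x₁, x₂, ξ) - φ (z₁, z₂, ξ)) / h : ℝ) : ℂ)) *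
        (((χ |L⁻¹ * ξ| ^ 2 : ℝ) : ℂ) *
          (β (x₁, x₂, ξ) * (starRingEnd ℂ) (β (z₁, z₂, ξ)))) with hJ
  have hfac : Kj h a j k φ β f χ x₁ x₂ z₁ z₂ = (((2 * π * h)⁻¹ : ℝ) : ℂ) *
      (J * ∫ b, f ((x₁ - b) / a) * (starRingEnd ℂ) (f ((z₁ - b) / a))) := by
    rw [Kj, hJ, ← integral_prod_mul, ← Measure.volume_eq_prod]
    congr 2
    funext p
    rw [hLinv, abs_mul L⁻¹, abs_of_pos (inv_pos.2 hL), Complex.ofReal_div, mul_div_assoc]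
    ring
  have hbound : ‖Kj h a j k φ β f χ x₁ x₂ z₁ z₂‖ ≤ h⁻¹ * (‖J‖ * (D * a)) := by
    rw [hfac, norm_mul, norm_mul, Complex.norm_real, Real.norm_of_nonneg (by positivity)]
    have h2π : (2 * π * h)⁻¹ ≤ h⁻¹ :=
      inv_anti₀ hh (le_mul_of_one_le_left hh.le (by linarith [Real.pi_gt_three]))
    gcongr
    exact hDb a ha x₁ z₁
  constructor
  · intro _
    calc _ ≤ h⁻¹ * (K * L * (D * a)) := hbound.trans (by gcongr)
      _ = _ := by rw [Real.rpow_add hh, Real.rpow_neg_one, hLdef]; ring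
  · intro hge
    have hd : 0 < |x₁ - z₁| := lt_of_lt_of_le (by positivity) hge
    calc _ ≤ h⁻¹ * (K * (√h / √|x₁ - z₁|) * (D * a)) :=
          hbound.trans (by gcongr; exact hvdc (sub_ne_zero.1 (abs_pos.1 hd)))
      _ = _ := by
          have e1 : h ^ (-(1 : ℝ) / 2) = h⁻¹ * √h := by
            rw [Real.sqrt_eq_rpow, ← Real.rpow_neg_one h, ← Real.rpow_add hh]; norm_num
          have e2 : |x₁ - z₁| ^ (-(1 : ℝ) / 2) = (√|x₁ - z₁|)⁻¹ := by
            rw [Real.sqrt_eq_rpow, ← Real.rpow_neg hd.le]; norm_num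
          rw [e1, e2]; ring
end

section
/- Let f ∈ C_c^∞(ℝ;ℂ) with supp f ⊆ [−R,R] and ∫_ℝ f(t) dt = 0, let g(x) := ∫_{−∞}^x f(t) dt (so g is smooth with supp g ⊆ [−R,R]), and let v : ℝ² → ℂ be smooth and compactly supported. Then for every a ≠ 0, every b ∈ ℝ and every x₂ ∈ ℝ, the wavelet coefficient satisfies the pointwise bound |X_v(a,b,x₂)| ≤ |a| · ‖g‖_{L²(ℝ)} · ‖∂_{x₁} v(·, x₂)‖_{L²([b − |a|R, b + |a|R])}. -/
open MeasureTheory Real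

/-- The wavelet coefficient in the first variable:
`X_v(a,b,x₂) = |a|^{-1/2} ∫ f(a⁻¹(y₁-b)) v(y₁,x₂) dy₁`. -/
noncomputable def Xv (f : ℝ → ℂ) (v : ℝ × ℝ → ℂ) (a b x₂ : ℝ) : ℂ :=
  ((|a| ^ (-(1 : ℝ) / 2) : ℝ) : ℂ) * ∫ y₁ : ℝ, f ((y₁ - b) / a) * v (y₁, x₂)

/-- The integral of `f` over `(-∞, x]` is an antiderivative of `f`. -/
theorem hasDerivAt_setIntegral_Iic {f : ℝ → ℂ} (hf : Continuous f) (hfi : Integrable f) (x : ℝ) :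
    HasDerivAt (fun x => ∫ t in Set.Iic x, f t) (f x) x := by
  have h : (fun x => ∫ t in Set.Iic x, f t) =
      fun x => (∫ t in Set.Iic 0, f t) + ∫ t in (0 : ℝ)..x, f t := by
    funext x
    rw [← intervalIntegral.integral_Iic_sub_Iic hfi.integrableOn hfi.integrableOn]
    ring
  rw [h]
  exact (intervalIntegral.integral_hasDerivAt_right (hf.intervalIntegrable _ _)
    (hf.stronglyMeasurableAtFilter _ _) hf.continuousAt).const_add _

/-- The antiderivative of a mean-zero function supported in `[-R, R]` vanishes off `[-R, R]`. -/
theorem setIntegral_Iic_eq_zero_of_notMem_Icc {f : ℝ → ℂ} {R : ℝ}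
    (hfs : tsupport f ⊆ Set.Icc (-R) R) (hf0 : ∫ t : ℝ, f t = 0) {x : ℝ}
    (hx : x ∉ Set.Icc (-R) R) : ∫ t in Set.Iic x, f t = 0 := by
  have hf_zero : ∀ t, t ∉ Set.Icc (-R) R → f t = 0 := fun t ht =>
    image_eq_zero_of_notMem_tsupport fun h => ht (hfs h)
  by_cases h : -R ≤ x
  · have hRx : R < x := not_le.mp fun h' => hx ⟨h, h'⟩
    rw [setIntegral_eq_integral_of_forall_compl_eq_zero, hf0]
    intro t ht
    exact hf_zero t fun h' => ht (h'.2.trans hRx.le)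
  · refine setIntegral_eq_zero_of_forall_eq_zero fun t ht => hf_zero t fun h' => h ?_
    exact h'.1.trans ht

/-- If `(y - b) / a` lies in `[-R, R]`, then `y` lies in `[b - |a| R, b + |a| R]`. -/
theorem mem_Icc_of_sub_div_mem_Icc {a b R y : ℝ} (ha : a ≠ 0)
    (h : (y - b) / a ∈ Set.Icc (-R) R) : y ∈ Set.Icc (b - |a| * R) (b + |a| * R) := by
  have h1 : |y - b| ≤ |a| * R := by
    have h2 := abs_le.mpr h
    rw [abs_div, div_le_iff₀ (abs_pos.mpr ha)] at h2
    linarith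
  have := abs_le.mp h1
  constructor <;> linarith

/-- Cauchy-Schwarz for the product of a rescaled function and a function,
where the rescaled function is supported in `S`. -/
theorem norm_integral_comp_sub_div_mul_le {g w : ℝ → ℂ} (hg : Continuous g)
    (hgc : HasCompactSupport g) (hw : Continuous w) (hwc : HasCompactSupport w)
    {a : ℝ} (ha : a ≠ 0) (b : ℝ) {S : Set ℝ} (hS : ∀ y, y ∉ S → g ((y - b) / a) = 0) :
    ‖∫ y, g ((y - b) / a) * w y‖ ≤
      |a| ^ ((1 : ℝ) / 2) * (∫ x, ‖g x‖ ^ 2) ^ ((1 : ℝ) / 2) *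
        (∫ y in S, ‖w y‖ ^ 2) ^ ((1 : ℝ) / 2) := by
  have hg2 : MemLp g 2 := hg.memLp_of_hasCompactSupport hgc
  have hgi : Integrable fun x => ‖g x‖ ^ 2 := hg2.integrable_norm_pow (by norm_num)
  have hGi : Integrable fun y => ‖g ((y - b) / a)‖ ^ 2 :=
    (hgi.comp_div ha).comp_sub_right b
  have hGm : AEStronglyMeasurable (fun y => g ((y - b) / a)) volume :=
    Continuous.aestronglyMeasurable (by fun_prop)
  have hG2 : MemLp (fun y => ‖g ((y - b) / a)‖) 2 :=
    ((memLp_two_iff_integrable_sq_norm hGm).mpr hGi).norm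
  have hw2 : MemLp (fun y => ‖w y‖) 2 := (hw.memLp_of_hasCompactSupport hwc).norm
  have hscale : ∫ y, ‖g ((y - b) / a)‖ ^ 2 = |a| * ∫ x, ‖g x‖ ^ 2 := by
    rw [integral_sub_right_eq_self (fun y => ‖g (y / a)‖ ^ 2) b,
      Measure.integral_comp_div (fun y => ‖g y‖ ^ 2) a, smul_eq_mul]
  have hset : ∫ y in S, g ((y - b) / a) * w y = ∫ y, g ((y - b) / a) * w y :=
    setIntegral_eq_integral_of_forall_compl_eq_zero fun y hy => by rw [hS y hy, zero_mul]
  have hholder := integral_mul_le_Lp_mul_Lq_of_nonneg (μ := volume.restrict S)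
    Real.HolderConjugate.two_two
    (Filter.Eventually.of_forall fun y => norm_nonneg (g ((y - b) / a)))
    (Filter.Eventually.of_forall fun y => norm_nonneg (w y))
    (by simpa using hG2.restrict S) (by simpa using hw2.restrict S)
  simp only [Real.rpow_two] at hholder
  calc ‖∫ y, g ((y - b) / a) * w y‖
      ≤ ∫ y in S, ‖g ((y - b) / a)‖ * ‖w y‖ := by
        rw [← hset]
        simpa only [norm_mul] using norm_integral_le_integral_norm
          (μ := volume.restrict S) fun y => g ((y - b) / a) * w y
    _ ≤ (∫ y in S, ‖g ((y - b) / a)‖ ^ 2) ^ ((1 : ℝ) / 2) *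
          (∫ y in S, ‖w y‖ ^ 2) ^ ((1 : ℝ) / 2) := hholder
    _ ≤ (∫ y, ‖g ((y - b) / a)‖ ^ 2) ^ ((1 : ℝ) / 2) *
          (∫ y in S, ‖w y‖ ^ 2) ^ ((1 : ℝ) / 2) := by
        gcongr
        · exact Filter.Eventually.of_forall fun y => by positivity
        · exact Measure.restrict_le_self
    _ = _ := by
        rw [hscale, Real.mul_rpow (abs_nonneg a) (by positivity)]

/-- Pointwise bound for the wavelet coefficient of a smooth compactly supported
function `v`, where `f` has mean zero and support in `[-R,R]` and `g` is the
antiderivative of `f`: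
`|X_v(a,b,x₂)| ≤ |a| ‖g‖_{L²(ℝ)} ‖∂_{x₁} v(·,x₂)‖_{L²([b-|a|R, b+|a|R])}`. -/
theorem Xv_pointwise_bound
    (R : ℝ) (f : ℝ → ℂ) (hf : ContDiff ℝ (⊤ : ℕ∞) f) (hfc : HasCompactSupport f)
    (hfs : tsupport f ⊆ Set.Icc (-R) R) (hf0 : ∫ t : ℝ, f t = 0)
    (g : ℝ → ℂ) (hg : ∀ x, g x = ∫ t in Set.Iic x, f t)
    (v : ℝ × ℝ → ℂ) (hv : ContDiff ℝ (⊤ : ℕ∞) v) (hvc : HasCompactSupport v)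
    (a b x₂ : ℝ) (ha : a ≠ 0) :
    ‖Xv f v a b x₂‖ ≤
      |a| * (∫ x : ℝ, ‖g x‖ ^ 2) ^ ((1 : ℝ) / 2) *
        (∫ y₁ in Set.Icc (b - |a| * R) (b + |a| * R),
            ‖deriv (fun t => v (t, x₂)) y₁‖ ^ 2) ^ ((1 : ℝ) / 2) := by
  have hfi : Integrable f := hf.continuous.integrable_of_hasCompactSupport hfc
  have hgd : ∀ x, HasDerivAt g (f x) x :=
    funext hg ▸ hasDerivAt_setIntegral_Iic hf.continuous hfi
  have hgcont : Continuous g := continuous_iff_continuousAt.mpr fun x => (hgd x).continuousAt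
  have hgz : ∀ x, x ∉ Set.Icc (-R) R → g x = 0 := fun x hx =>
    (hg x).trans (setIntegral_Iic_eq_zero_of_notMem_Icc hfs hf0 hx)
  have hgc : HasCompactSupport g := HasCompactSupport.intro isCompact_Icc hgz
  set w : ℝ → ℂ := fun t => v (t, x₂)
  have hw : ContDiff ℝ (⊤ : ℕ∞) w := hv.comp (contDiff_id.prodMk contDiff_const)
  have hwc : HasCompactSupport w := by
    refine HasCompactSupport.intro (hvc.isCompact.image continuous_fst) fun t ht => ?_
    exact image_eq_zero_of_notMem_tsupport (f := v) fun h => ht ⟨(t, x₂), h, rfl⟩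
  have hw'cont : Continuous (deriv w) := hw.continuous_deriv (by simp)
  have hw'c : HasCompactSupport (deriv w) := hwc.deriv
  have hGd : ∀ y, HasDerivAt (fun y => a * g ((y - b) / a)) (f ((y - b) / a)) y := by
    intro y
    have h := ((hgd ((y - b) / a)).scomp y
      (((hasDerivAt_id y).sub_const b).div_const a)).const_mul (a : ℂ)
    have hval : (a : ℂ) * (1 / a : ℝ) • f ((y - b) / a) = f ((y - b) / a) := by
      rw [Complex.real_smul]
      push_cast
      field_simp [Complex.ofReal_ne_zero.mpr ha]
    exact hval ▸ h
  have hGcont : Continuous fun y => (a : ℂ) * g ((y - b) / a) := by fun_prop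
  have hFcont : Continuous fun y => f ((y - b) / a) := hf.continuous.comp (by fun_prop)
  have hparts := integral_mul_deriv_eq_deriv_mul_of_integrable (fun y _ => hGd y)
    (fun y _ => (hw.differentiable (by simp) y).hasDerivAt)
    ((hGcont.mul hw'cont).integrable_of_hasCompactSupport hw'c.mul_left)
    ((hFcont.mul hw.continuous).integrable_of_hasCompactSupport hwc.mul_left)
    ((hGcont.mul hw.continuous).integrable_of_hasCompactSupport hwc.mul_left)
  have hnorm : ‖∫ y, f ((y - b) / a) * w y‖ =
      |a| * ‖∫ y, g ((y - b) / a) * deriv w y‖ := by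
    rw [← norm_neg, ← hparts]
    simp only [mul_assoc, integral_const_mul, norm_mul, Complex.norm_real, Real.norm_eq_abs]
  have ha' : 0 < |a| := abs_pos.mpr ha
  have hpow : |a| ^ (-(1 : ℝ) / 2) * (|a| * |a| ^ ((1 : ℝ) / 2)) = |a| := by
    rw [mul_left_comm, ← Real.rpow_add ha']
    norm_num
  have hbound := norm_integral_comp_sub_div_mul_le hgcont hgc hw'cont hw'c ha b
    (S := Set.Icc (b - |a| * R) (b + |a| * R))
    fun y hy => hgz _ fun h => hy (mem_Icc_of_sub_div_mem_Icc ha h)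
  calc ‖Xv f v a b x₂‖
      = |a| ^ (-(1 : ℝ) / 2) * (|a| * ‖∫ y, g ((y - b) / a) * deriv w y‖) := by
        rw [← hnorm, Xv, norm_mul, Complex.norm_real, Real.norm_of_nonneg (by positivity)]
    _ ≤ |a| ^ (-(1 : ℝ) / 2) * (|a| * (|a| ^ ((1 : ℝ) / 2) *
          (∫ x, ‖g x‖ ^ 2) ^ ((1 : ℝ) / 2) *
          (∫ y in Set.Icc (b - |a| * R) (b + |a| * R), ‖deriv w y‖ ^ 2) ^ ((1 : ℝ) / 2))) := by
        gcongr
    _ = |a| ^ (-(1 : ℝ) / 2) * (|a| * |a| ^ ((1 : ℝ) / 2)) *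
          (∫ x, ‖g x‖ ^ 2) ^ ((1 : ℝ) / 2) *
          (∫ y in Set.Icc (b - |a| * R) (b + |a| * R), ‖deriv w y‖ ^ 2) ^ ((1 : ℝ) / 2) := by
        ring
    _ = _ := by rw [hpow]
end

section
/- Let f ∈ C_c^∞(ℝ;ℂ) with supp f ⊆ [−R,R] and ∫_ℝ f(t) dt = 0, let g(x) := ∫_{−∞}^x f(t) dt, and let v : ℝ² → ℂ be smooth and compactly supported. Then for every a ≠ 0, the wavelet coefficient satisfies ( ∬_{ℝ²} |X_v(a,b,x₂)|² db dx₂ )^{1/2} ≤ √(2R) · ‖g‖_{L²(ℝ)} · |a|^{3/2} · ‖∂_{x₁} v‖_{L²(ℝ²)}. (This is the j = 0 case of the wavelet coefficient estimate: combining with the Plancherel identity for the semiclassical Fourier transform in x₂, the same bound holds for ‖F_h[X_v(a,b,·)]‖ in L² of (ξ₂,b).) -/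
open MeasureTheory Real

section

variable {R : ℝ} {f g : ℝ → ℂ}

/-- The antiderivative of a continuous integrable function, based at `-∞`, is differentiable. -/
lemma hasDerivAt_of_eq_integral_Iic (hf : Continuous f) (hfi : Integrable f)
    (hg : ∀ x, g x = ∫ t in Set.Iic x, f t) (x : ℝ) : HasDerivAt g (f x) x := by
  have h : g = fun x => (∫ t in Set.Iic 0, f t) + ∫ t in (0 : ℝ)..x, f t := by
    funext y
    rw [hg, ← intervalIntegral.integral_Iic_sub_Iic hfi.integrableOn hfi.integrableOn]
    ring
  rw [h]
  exact (hf.integral_hasStrictDerivAt 0 x).hasDerivAt.const_add _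

/-- The antiderivative of a mean zero function supported in `[-R, R]` vanishes off `[-R, R]`. -/
lemma integral_Iic_eq_zero_of_notMem_Icc (hfs : tsupport f ⊆ Set.Icc (-R) R)
    (hf0 : ∫ t : ℝ, f t = 0) (hg : ∀ x, g x = ∫ t in Set.Iic x, f t) {x : ℝ}
    (hx : x ∉ Set.Icc (-R) R) : g x = 0 := by
  have hz : ∀ t, t ∉ Set.Icc (-R) R → f t = 0 := fun t ht =>
    image_eq_zero_of_notMem_tsupport fun h => ht (hfs h)
  rw [hg]
  by_cases h : x < -R
  · refine setIntegral_eq_zero_of_forall_eq_zero fun t ht => hz t fun h' => ?_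
    exact absurd (h'.1.trans ht) (not_le.2 h)
  · have h2 : R < x := by
      by_contra h2
      exact hx ⟨not_lt.1 h, not_lt.1 h2⟩
    rw [setIntegral_eq_integral_of_forall_compl_eq_zero, hf0]
    intro t ht
    exact hz t fun h' => ht (h'.2.trans h2.le)

end

lemma hasDerivAt_fst_slice {v : ℝ × ℝ → ℂ} (hv : Differentiable ℝ v) (q : ℝ × ℝ) :
    HasDerivAt (fun t => v (t, q.2)) (fderiv ℝ v q (1, 0)) q.1 :=
  (hv q).hasFDerivAt.comp_hasDerivAt (f := fun t : ℝ => (t, q.2)) q.1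
    ((hasDerivAt_id q.1).prodMk (hasDerivAt_const q.1 q.2))

/-- Cauchy-Schwarz for continuous functions on a compact interval. -/
lemma sq_norm_setIntegral_Icc_mul_le {c d : ℝ} {g w : ℝ → ℂ} (hg : Continuous g)
    (hw : Continuous w) :
    ‖∫ t in Set.Icc c d, g t * w t‖ ^ 2 ≤
      (∫ t in Set.Icc c d, ‖g t‖ ^ 2) * ∫ t in Set.Icc c d, ‖w t‖ ^ 2 := by
  have hL : ∀ {u : ℝ → ℂ}, Continuous u →
      MemLp (fun t => ‖u t‖) (ENNReal.ofReal 2) (volume.restrict (Set.Icc c d)) := by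
    intro u hu
    rw [ENNReal.ofReal_ofNat, memLp_two_iff_integrable_sq hu.norm.aestronglyMeasurable]
    exact (hu.norm.pow 2).continuousOn.integrableOn_Icc
  have h := integral_mul_le_Lp_mul_Lq_of_nonneg Real.HolderConjugate.two_two
    (.of_forall fun t => norm_nonneg (g t)) (.of_forall fun t => norm_nonneg (w t)) (hL hg) (hL hw)
  have h1 : ‖∫ t in Set.Icc c d, g t * w t‖ ≤ ∫ t in Set.Icc c d, ‖g t‖ * ‖w t‖ := by
    simpa only [norm_mul] using norm_integral_le_integral_norm
      (μ := volume.restrict (Set.Icc c d)) fun t => g t * w t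
  have h2 := h1.trans h
  simp only [Real.rpow_two, ← Real.sqrt_eq_rpow] at h2
  calc _ ≤ (√(∫ t in Set.Icc c d, ‖g t‖ ^ 2) * √(∫ t in Set.Icc c d, ‖w t‖ ^ 2)) ^ 2 := by
        gcongr
    _ = _ := by
        rw [mul_pow, Real.sq_sqrt (by positivity), Real.sq_sqrt (by positivity)]

/-- Averaging the translates of an integrable function over a finite measure multiplies the
integral by the total mass. -/
lemma integrable_and_integral_integral_fst_translate {μ : Measure ℝ} [IsFiniteMeasure μ]
    {F : ℝ × ℝ → ℝ} (hF : Continuous F) (hFi : Integrable F) (a : ℝ) :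
    Integrable (fun p : ℝ × ℝ => ∫ t, F (p.1 + a * t, p.2) ∂μ) ∧
      ∫ p : ℝ × ℝ, ∫ t, F (p.1 + a * t, p.2) ∂μ = μ.real Set.univ * ∫ p, F p := by
  have hT : ∀ t : ℝ, ∀ p : ℝ × ℝ, (p.1 + a * t, p.2) = p + (a * t, 0) := by
    intro t p; ext <;> simp
  have hI : Integrable (Function.uncurry fun (p : ℝ × ℝ) (t : ℝ) => F (p.1 + a * t, p.2))
      (volume.prod μ) := by
    have hc : Continuous (Function.uncurry fun (p : ℝ × ℝ) (t : ℝ) => F (p.1 + a * t, p.2)) := by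
      unfold Function.uncurry
      fun_prop
    rw [integrable_prod_iff' hc.aestronglyMeasurable]
    simp only [Function.uncurry, hT]
    refine ⟨.of_forall fun t => hFi.comp_add_right _, ?_⟩
    simp_rw [integral_add_right_eq_self (μ := (volume : Measure (ℝ × ℝ))) (fun p => ‖F p‖)]
    exact integrable_const _
  refine ⟨hI.integral_prod_left, ?_⟩
  rw [integral_integral_swap hI]
  simp only [hT, integral_add_right_eq_self (μ := (volume : Measure (ℝ × ℝ))) F,
    integral_const, smul_eq_mul]

/-- Integration by parts, moving the derivative from the wavelet to the function `v`. -/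
lemma Xv_eq_integral_antideriv {f g : ℝ → ℂ} (hf : Continuous f)
    (hfc : HasCompactSupport f) (hgd : ∀ x, HasDerivAt g (f x) x) (hgc : HasCompactSupport g)
    {v : ℝ × ℝ → ℂ} (hv : ContDiff ℝ 1 v) {a : ℝ} (ha : a ≠ 0) (b x₂ : ℝ) :
    Xv f v a b x₂ = ((|a| ^ (-(1 : ℝ) / 2) : ℝ) : ℂ) *
      (-(|a| * a : ℝ) * ∫ t, g t * fderiv ℝ v (b + a * t, x₂) (1, 0)) := by
  have hgcont : Continuous g := continuous_iff_continuousAt.2 fun x => (hgd x).continuousAt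
  have hd : ∀ t, HasDerivAt (fun t => v (b + a * t, x₂))
      (a * fderiv ℝ v (b + a * t, x₂) (1, 0)) t := by
    intro t
    have h1 : HasDerivAt (fun t : ℝ => b + a * t) a t := by
      simpa using ((hasDerivAt_id t).const_mul a).const_add b
    have h2 := (hasDerivAt_fst_slice (hv.differentiable one_ne_zero) (b + a * t, x₂)).scomp t h1
    rwa [Complex.real_smul] at h2
  have hwc : Continuous fun t => fderiv ℝ v (b + a * t, x₂) (1, 0) := by
    have := hv.continuous_fderiv one_ne_zero
    fun_prop
  have hvc : Continuous fun t => v (b + a * t, x₂) := by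
    have := hv.continuous
    fun_prop
  have hibp := integral_mul_deriv_eq_deriv_mul_of_integrable (fun x _ => hgd x) (fun x _ => hd x)
    ((hgcont.mul (continuous_const.mul hwc)).integrable_of_hasCompactSupport hgc.mul_right)
    ((hf.mul hvc).integrable_of_hasCompactSupport hfc.mul_right)
    ((hgcont.mul hvc).integrable_of_hasCompactSupport hgc.mul_right)
  have hsub : ∫ y, f ((y - b) / a) * v (y, x₂) = |a| * ∫ t, f t * v (b + a * t, x₂) := by
    have h1 := Measure.integral_comp_div (fun t => f t * v (b + a * t, x₂)) a
    have h2 := integral_sub_right_eq_self (μ := (volume : Measure ℝ))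
      (fun y => f (y / a) * v (b + a * (y / a), x₂)) b
    rw [← Complex.real_smul, ← h1, ← h2]
    refine integral_congr_ae (.of_forall fun y => ?_)
    simp only
    rw [mul_div_cancel₀ _ ha, add_sub_cancel]
  rw [Xv, hsub]
  have h3 : ∫ t, f t * v (b + a * t, x₂) =
      -(a * ∫ t, g t * fderiv ℝ v (b + a * t, x₂) (1, 0)) := by
    rw [← integral_const_mul, ← neg_eq_iff_eq_neg, ← hibp]
    congr 1; funext t; ring
  rw [h3]
  push_cast
  ring

/-- `L²_{b,x₂}` bound for the wavelet coefficient of a smooth compactly supported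
function `v`, where `f` has mean zero and support in `[-R,R]` and `g` is the
antiderivative of `f`:
`‖X_v(a,·,·)‖_{L²(db dx₂)} ≤ √(2R) ‖g‖_{L²(ℝ)} |a|^{3/2} ‖∂_{x₁} v‖_{L²(ℝ²)}`.
(By Plancherel for the semiclassical Fourier transform in `x₂`, the same bound
holds for `F_h[X_v]` in `L²(dξ₂ db)`.) -/
theorem Xv_L2_bound
    (R : ℝ) (f : ℝ → ℂ) (hf : ContDiff ℝ (⊤ : ℕ∞) f) (hfc : HasCompactSupport f)
    (hfs : tsupport f ⊆ Set.Icc (-R) R) (hf0 : ∫ t : ℝ, f t = 0)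
    (g : ℝ → ℂ) (hg : ∀ x, g x = ∫ t in Set.Iic x, f t)
    (v : ℝ × ℝ → ℂ) (hv : ContDiff ℝ (⊤ : ℕ∞) v) (hvc : HasCompactSupport v)
    (a : ℝ) (ha : a ≠ 0) :
    (∫ p : ℝ × ℝ, ‖Xv f v a p.1 p.2‖ ^ 2) ^ ((1 : ℝ) / 2) ≤
      Real.sqrt (2 * R) * (∫ x : ℝ, ‖g x‖ ^ 2) ^ ((1 : ℝ) / 2) * |a| ^ ((3 : ℝ) / 2) *
        (∫ q : ℝ × ℝ, ‖deriv (fun t => v (t, q.2)) q.1‖ ^ 2) ^ ((1 : ℝ) / 2) := by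
  have hcf := hf.continuous
  have hgd := hasDerivAt_of_eq_integral_Iic hcf (hcf.integrable_of_hasCompactSupport hfc) hg
  have hgz : ∀ x, x ∉ Set.Icc (-R) R → g x = 0 := fun x =>
    integral_Iic_eq_zero_of_notMem_Icc hfs hf0 hg
  have hgcont : Continuous g := continuous_iff_continuousAt.2 fun x => (hgd x).continuousAt
  have hgc : HasCompactSupport g := HasCompactSupport.intro isCompact_Icc hgz
  have hv1 : ContDiff ℝ 1 v := hv.of_le (mod_cast le_top)
  simp only [(hasDerivAt_fst_slice (hv1.differentiable one_ne_zero) _).deriv]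
  set w : ℝ × ℝ → ℂ := fun q => fderiv ℝ v q (1, 0)
  have hwcont : Continuous w := by
    have := hv1.continuous_fderiv one_ne_zero
    fun_prop
  have hwc : HasCompactSupport w := hvc.fderiv_apply (𝕜 := ℝ) (1, 0)
  have hF : Continuous fun q => ‖w q‖ ^ 2 := by fun_prop
  have hFi : Integrable fun q => ‖w q‖ ^ 2 :=
    hF.integrable_of_hasCompactSupport (hwc.comp_left (g := fun z : ℂ => ‖z‖ ^ 2) (by simp))
  obtain ⟨hint, hval⟩ := integrable_and_integral_integral_fst_translate
    (μ := volume.restrict (Set.Icc (-R) R)) hF hFi a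
  have hpt : ∀ p : ℝ × ℝ, ‖Xv f v a p.1 p.2‖ ^ 2 ≤
      (|a| ^ 3 * ∫ x, ‖g x‖ ^ 2) *
        ∫ t in Set.Icc (-R) R, ‖w (p.1 + a * t, p.2)‖ ^ 2 := by
    intro p
    have hcs := sq_norm_setIntegral_Icc_mul_le (c := -R) (d := R) hgcont
      (w := fun t => w (p.1 + a * t, p.2)) (by fun_prop)
    rw [setIntegral_eq_integral_of_forall_compl_eq_zero (fun t ht => by simp [hgz t ht]),
      setIntegral_eq_integral_of_forall_compl_eq_zero
        (f := fun t => ‖g t‖ ^ 2) (fun t ht => by simp [hgz t ht])] at hcs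
    rw [Xv_eq_integral_antideriv hcf hfc hgd hgc hv1 ha]
    have hr : (|a| ^ (-(1 : ℝ) / 2)) ^ 2 = |a|⁻¹ := by
      rw [← Real.rpow_natCast, ← Real.rpow_mul (abs_nonneg a)]
      norm_num [Real.rpow_neg_one]
    have ha' : |a| ≠ 0 := abs_ne_zero.2 ha
    rw [norm_mul, norm_mul, mul_pow, mul_pow, norm_neg, Complex.norm_real, Complex.norm_real,
      Real.norm_eq_abs, Real.norm_eq_abs, sq_abs, hr, abs_mul, abs_abs, ← mul_assoc, mul_assoc]
    have hc : |a|⁻¹ * (|a| * |a|) ^ 2 = |a| ^ 3 := by field_simp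
    rw [← mul_assoc, hc, mul_assoc]
    gcongr
  have hmain := integral_mono_of_nonneg (.of_forall fun p => sq_nonneg _)
    (hint.const_mul (|a| ^ 3 * ∫ x, ‖g x‖ ^ 2)) (.of_forall hpt)
  rw [integral_const_mul, hval, measureReal_restrict_apply_univ, Real.volume_real_Icc] at hmain
  have hR : max (R - -R) 0 = √(2 * R) ^ 2 := by
    rcases le_total 0 R with h | h
    · rw [Real.sq_sqrt (by linarith), max_eq_left (by linarith)]; ring
    · rw [Real.sqrt_eq_zero_of_nonpos (by linarith), max_eq_right (by linarith)]; simp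
  have ha3 : |a| ^ 3 = (|a| ^ ((3 : ℝ) / 2)) ^ 2 := by
    rw [← Real.rpow_natCast, ← Real.rpow_natCast, ← Real.rpow_mul (abs_nonneg a)]
    norm_num
  rw [hR, ha3] at hmain
  simp only [← Real.sqrt_eq_rpow]
  refine Real.sqrt_le_iff.2 ⟨by positivity, hmain.trans_eq ?_⟩
  change _ = (_ * _ * _ * √(∫ q, ‖w q‖ ^ 2)) ^ 2
  have h1 : √(∫ x, ‖g x‖ ^ 2) ^ 2 = ∫ x, ‖g x‖ ^ 2 := Real.sq_sqrt (by positivity)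
  have h2 : √(∫ q, ‖w q‖ ^ 2) ^ 2 = ∫ q, ‖w q‖ ^ 2 := Real.sq_sqrt (by positivity)
  simp only [mul_pow, h1, h2]
  ring
end

section
/- Fix an integer k ≥ 1 and constants A_0, A_1, A_2, … . Let h ∈ (0,1] and N > 0, let v : ℝ² → ℂ be smooth and compactly supported with ‖∂_{x₁} (h^{k+1} ∂_{x₂}^{k+1})^{M} v‖_{L²(ℝ²)} ≤ A_M h^{M} N for every integer M ≥ 0, and let f ∈ C_c^∞(ℝ;ℂ) with ∫_ℝ f = 0. Let χ ∈ C^∞(ℝ;ℝ) with 0 ≤ χ ≤ 1 and supp χ ⊆ [1/2, 3/2]. Then for every integer M ≥ 0 there is a constant C_M, depending only on f, χ, k, M and the constants A_i (and independent of h, a, j, v, N), such that for every integer j ≥ 1 and every a with 0 < |a| ≤ 1: ( ∬_{ℝ²} | χ(2^{−j} h^{−1/(k+1)} |ξ₂|) · F_h[X_v(a,b,·)](ξ₂) |² dξ₂ db )^{1/2} ≤ C_M 2^{−jM} |a|^{3/2} N. -/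
open MeasureTheory Real

/-- The semiclassical Fourier transform in one variable:
`F_h[w](ξ) = (2πh)^{-1/2} ∫ e^{-ixξ/h} w(x) dx`. -/
noncomputable def Fh (h : ℝ) (w : ℝ → ℂ) (ξ : ℝ) : ℂ :=
  (((2 * π * h) ^ (-(1 : ℝ) / 2) : ℝ) : ℂ) *
    ∫ x : ℝ, Complex.exp (-Complex.I * (x : ℂ) * (ξ : ℂ) / (h : ℂ)) * w x

open scoped FourierTransform ENNReal ContDiff

theorem HasCompactSupport.comp_prodMk_right {u : ℝ × ℝ → ℂ} (hc : HasCompactSupport u) (y : ℝ) :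
    HasCompactSupport fun s => u (y, s) := by
  refine HasCompactSupport.intro (hc.isCompact.image continuous_snd) fun s hs => ?_
  by_contra hne
  exact hs ⟨(y, s), subset_tsupport u hne, rfl⟩

theorem deriv_prodMk_right_eq_fderiv {u : ℝ × ℝ → ℂ} (hu : ContDiff ℝ ∞ u) (q : ℝ × ℝ) :
    deriv (fun s => u (q.1, s)) q.2 = fderiv ℝ u q (0, 1) := by
  have h := (hu.differentiable (by simp) q).hasFDerivAt
  exact (h.comp_hasDerivAt q.2 (f := fun s => (q.1, s))
    ((hasDerivAt_const q.2 q.1).prodMk (hasDerivAt_id q.2))).deriv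

theorem hasDerivAt_prodMk_left {u : ℝ × ℝ → ℂ} (hu : ContDiff ℝ ∞ u) (q : ℝ × ℝ) :
    HasDerivAt (fun y => u (y, q.2)) (fderiv ℝ u q (1, 0)) q.1 := by
  have h := (hu.differentiable (by simp) q).hasFDerivAt
  exact h.comp_hasDerivAt q.1 (f := fun y => (y, q.2))
    ((hasDerivAt_id q.1).prodMk (hasDerivAt_const q.1 q.2))

theorem ContDiff.fderiv_apply_const {u : ℝ × ℝ → ℂ} (hu : ContDiff ℝ ∞ u) (e : ℝ × ℝ) :
    ContDiff ℝ ∞ fun q => fderiv ℝ u q e :=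
  (hu.fderiv_right (m := ∞) (by simp)).clm_apply contDiff_const

theorem contDiff_hasCompactSupport_iteratedDeriv_snd {v : ℝ × ℝ → ℂ} (hv : ContDiff ℝ ∞ v)
    (hc : HasCompactSupport v) (n : ℕ) :
    ContDiff ℝ ∞ (fun q : ℝ × ℝ => iteratedDeriv n (fun s => v (q.1, s)) q.2) ∧
      HasCompactSupport (fun q : ℝ × ℝ => iteratedDeriv n (fun s => v (q.1, s)) q.2) := by
  induction n with
  | zero => simpa using ⟨hv, hc⟩
  | succ n ih =>
    have h : (fun q : ℝ × ℝ => iteratedDeriv (n + 1) (fun s => v (q.1, s)) q.2) =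
        fun q => fderiv ℝ (fun q : ℝ × ℝ => iteratedDeriv n (fun s => v (q.1, s)) q.2) q (0, 1) := by
      ext q
      rw [← deriv_prodMk_right_eq_fderiv ih.1 q, iteratedDeriv_succ]
    rw [h]
    exact ⟨ih.1.fderiv_apply_const _, ih.2.fderiv_apply ℝ _⟩

theorem exists_hasCompactSupport_antiderivative {f : ℝ → ℂ} (hf : Continuous f)
    (hfc : HasCompactSupport f) (hf0 : ∫ t : ℝ, f t = 0) :
    ∃ F : ℝ → ℂ, (∀ t, HasDerivAt F (f t) t) ∧ HasCompactSupport F := by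
  obtain ⟨R, hR⟩ := hfc.isCompact.isBounded.subset_closedBall 0
  have hz : ∀ t, R < |t| → f t = 0 := fun t ht =>
    image_eq_zero_of_notMem_tsupport fun h => ht.not_ge (by simpa using hR h)
  refine ⟨fun t => ∫ x in (-(R + 1))..t, f x, fun t => ?_, ?_⟩
  · exact intervalIntegral.integral_hasDerivAt_right (hf.intervalIntegrable _ _)
      (hf.stronglyMeasurableAtFilter _ _) hf.continuousAt
  · refine HasCompactSupport.intro (isCompact_Icc (a := -(R + 1)) (b := R + 1)) fun t ht => ?_
    rw [Set.mem_Icc, not_and_or, not_le, not_le] at ht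
    rcases lt_or_ge t (-(R + 1)) with h | h
    · rw [intervalIntegral.integral_symm, intervalIntegral.integral_of_le h.le,
        setIntegral_congr_fun measurableSet_Ioc (g := fun _ => (0 : ℂ)), integral_zero, neg_zero]
      intro x hx
      exact hz x (lt_abs.2 (Or.inr (by linarith [hx.2])))
    · rw [intervalIntegral.integral_of_le h, setIntegral_eq_integral_of_forall_compl_eq_zero, hf0]
      intro x hx
      rw [Set.mem_Ioc, not_and_or, not_lt, not_le] at hx
      refine hz x (lt_abs.2 ?_)
      rcases hx with hx | hx
      · exact Or.inr (by linarith)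
      · exact Or.inl (by rcases ht with ht | ht <;> linarith)

theorem Xv_eq_integral (f : ℝ → ℂ) (v : ℝ × ℝ → ℂ) {a : ℝ} (ha : a ≠ 0) (b x : ℝ) :
    Xv f v a b x =
      ((|a| ^ ((1 : ℝ) / 2) : ℝ) : ℂ) * ∫ t : ℝ, f t * v (b + a * t, x) := by
  have h1 := Measure.integral_comp_mul_left
    (fun y : ℝ => f (y / a) * v (b + y, x)) a
  have h2 := integral_add_left_eq_self (μ := volume)
    (fun y : ℝ => f ((y - b) / a) * v (y, x)) b
  simp only [mul_div_cancel_left₀ _ ha, add_sub_cancel_left] at h1 h2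
  rw [Xv, h1, ← h2, Complex.real_smul, ← mul_assoc, ← Complex.ofReal_mul, abs_inv,
    ← Real.rpow_neg_one, ← Real.rpow_add (abs_pos.mpr ha)]
  norm_num

theorem integral_mul_comp_eq_neg_mul_integral {f F : ℝ → ℂ} (hf : Continuous f)
    (hF : ∀ t, HasDerivAt F (f t) t) (hFc : HasCompactSupport F) {u u' : ℝ → ℂ}
    (hu : ∀ t, HasDerivAt u (u' t) t) (hu' : Continuous u') (a b : ℝ) :
    ∫ t, f t * u (b + a * t) = -(a * ∫ t, F t * u' (b + a * t)) := by
  have hFcont : Continuous F := continuous_iff_continuousAt.2 fun t => (hF t).continuousAt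
  have hucont : Continuous u := continuous_iff_continuousAt.2 fun t => (hu t).continuousAt
  have hfc : HasCompactSupport f := by
    have : f = deriv F := funext fun t => (hF t).deriv.symm
    exact this ▸ hFc.deriv
  have hd : ∀ t, HasDerivAt (fun t => u (b + a * t)) (a * u' (b + a * t)) t := fun t => by
    have h : HasDerivAt (fun t => b + a * t) a t := by
      simpa using ((hasDerivAt_id t).const_mul a).const_add b
    simpa [Function.comp_def] using! (hu (b + a * t)).scomp t h
  have := integral_mul_deriv_eq_deriv_mul_of_integrable (u := F) (u' := f)
    (fun t _ => hF t) (fun t _ => hd t)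
    (Continuous.integrable_of_hasCompactSupport (by fun_prop) hFc.mul_right)
    (Continuous.integrable_of_hasCompactSupport (by fun_prop) hfc.mul_right)
    (Continuous.integrable_of_hasCompactSupport (by fun_prop) hFc.mul_right)
  rw [← neg_eq_iff_eq_neg] at this
  rw [← this, ← integral_const_mul]
  congr 2
  ext t
  ring

theorem Fh_integral_swap {ψ : ℝ → ℂ} (hψ : Continuous ψ) (hψc : HasCompactSupport ψ)
    {u : ℝ × ℝ → ℂ} (hu : Continuous u) (huc : HasCompactSupport u) (h a b ξ : ℝ) :
    Fh h (fun x => ∫ t, ψ t * u (b + a * t, x)) ξ =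
      ∫ t, ψ t * Fh h (fun x => u (b + a * t, x)) ξ := by
  have key := integral_integral_swap_of_hasCompactSupport (μ := volume) (ν := volume)
    (f := fun x t : ℝ => (((2 * π * h) ^ (-(1 : ℝ) / 2) : ℝ) : ℂ) *
      (Complex.exp (-Complex.I * (x : ℂ) * (ξ : ℂ) / (h : ℂ)) * (ψ t * u (b + a * t, x))))
    (by simp only [Function.uncurry_def]; fun_prop)
    (by
      refine HasCompactSupport.intro
        ((huc.isCompact.image continuous_snd).prod hψc.isCompact) fun p hp => ?_
      rcases p with ⟨x, t⟩
      by_contra hne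
      simp only [Function.uncurry_apply_pair, mul_eq_zero, not_or] at hne
      exact hp ⟨⟨(b + a * t, x), subset_tsupport u hne.2.2.2, rfl⟩, subset_tsupport ψ hne.2.2.1⟩)
  simp_rw [Fh, ← integral_const_mul]
  rw [key]
  congr! 4
  ring

theorem lintegral_comp_mul_left_real (g : ℝ → ℝ≥0∞) {c : ℝ} (hc : c ≠ 0) :
    ∫⁻ x, g (c * x) = ENNReal.ofReal |c⁻¹| * ∫⁻ x, g x := by
  rw [← (measurableEmbedding_mulLeft₀ hc).lintegral_map, Real.map_volume_mul_left hc,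
    lintegral_smul_measure, smul_eq_mul]

theorem Fh_eq_fourier {h : ℝ} (w : ℝ → ℂ) (ξ : ℝ) :
    Fh h w ξ = (((2 * π * h) ^ (-(1 : ℝ) / 2) : ℝ) : ℂ) * 𝓕 w ((2 * π * h)⁻¹ * ξ) := by
  rw [Fh, Real.fourier_real_eq_integral_exp_smul]
  congr 2
  ext x
  rw [smul_eq_mul]
  congr 2
  push_cast
  field_simp

theorem Fh_iteratedDeriv {h : ℝ} {u : ℝ → ℂ} (hu : ContDiff ℝ ∞ u)
    (hc : HasCompactSupport u) (n : ℕ) (ξ : ℝ) :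
    Fh h (iteratedDeriv n u) ξ = (Complex.I * ξ / h) ^ n * Fh h u ξ := by
  have hi : ∀ m : ℕ, (m : ℕ∞) ≤ ⊤ → Integrable (iteratedDeriv m u) := fun m _ => by
    refine (hu.continuous_iteratedDeriv m (mod_cast le_top)).integrable_of_hasCompactSupport ?_
    clear * - hc
    induction m with
    | zero => simpa using hc
    | succ m ih => rw [iteratedDeriv_succ]; exact ih.deriv
  rw [Fh_eq_fourier, Fh_eq_fourier, Real.fourier_iteratedDeriv (N := ⊤) hu hi le_top]
  simp only [smul_eq_mul]
  rw [mul_left_comm]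
  congr 2
  push_cast
  field_simp

theorem lintegral_enorm_Fh_sq {h : ℝ} (hh : 0 < h) {u : ℝ → ℂ} (hu : ContDiff ℝ ∞ u)
    (hc : HasCompactSupport u) :
    ∫⁻ ξ, ‖Fh h u ξ‖ₑ ^ 2 = ∫⁻ x, ‖u x‖ₑ ^ 2 := by
  have hconv : ∀ s : SchwartzMap ℝ ℂ, ∫⁻ x, ‖s x‖ₑ ^ 2 = ENNReal.ofReal (∫ x, ‖s x‖ ^ 2) := by
    intro s
    rw [ofReal_integral_eq_lintegral_ofReal (s.memLp 2 volume).norm.integrable_sq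
      (ae_of_all _ fun x => by positivity)]
    simp [ENNReal.ofReal_pow]
  have hP : ∫⁻ ξ, ‖𝓕 u ξ‖ₑ ^ 2 = ∫⁻ x, ‖u x‖ₑ ^ 2 := by
    have := hconv (𝓕 (hc.toSchwartzMap hu))
    rw [SchwartzMap.integral_norm_sq_fourier, ← hconv] at this
    simpa [SchwartzMap.fourier_coe] using! this
  rw [← hP]
  simp_rw [Fh_eq_fourier, enorm_mul, mul_pow]
  rw [lintegral_const_mul' _ _ (by finiteness)]
  rw [lintegral_comp_mul_left_real (fun ξ => ‖𝓕 u ξ‖ₑ ^ 2) (by positivity), ← mul_assoc]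
  have hpos : 0 < 2 * π * h := by positivity
  rw [← ofReal_norm, Complex.norm_real, ← ENNReal.ofReal_pow (norm_nonneg _),
    ← ENNReal.ofReal_mul (by positivity), inv_inv, Real.norm_eq_abs, sq_abs, ← Real.rpow_natCast,
    ← Real.rpow_mul hpos.le, abs_of_pos hpos]
  norm_num only [Real.rpow_neg_one, inv_mul_cancel₀ hpos.ne', ENNReal.ofReal_one, one_mul]

theorem Fh_Xv_eq {f F : ℝ → ℂ} (hf : Continuous f) (hF : ∀ t, HasDerivAt F (f t) t)
    (hFc : HasCompactSupport F) {v : ℝ × ℝ → ℂ} (hv : ContDiff ℝ ∞ v)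
    (hvc : HasCompactSupport v) {a : ℝ} (ha : a ≠ 0) (n : ℕ) (h b ξ : ℝ) :
    (Complex.I * ξ / h) ^ n * Fh h (Xv f v a b) ξ =
      -(((|a| ^ ((1 : ℝ) / 2) : ℝ) : ℂ) * a * ∫ t, F t * Fh h (fun x =>
        deriv (fun y => iteratedDeriv n (fun s => v (y, s)) x) (b + a * t)) ξ) := by
  have hFcont : Continuous F := continuous_iff_continuousAt.2 fun t => (hF t).continuousAt
  have hfc : HasCompactSupport f := by
    have : f = deriv F := funext fun t => (hF t).deriv.symm
    exact this ▸ hFc.deriv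
  obtain ⟨hw, hwc⟩ := contDiff_hasCompactSupport_iteratedDeriv_snd hv hvc n
  set w : ℝ × ℝ → ℂ := fun q => iteratedDeriv n (fun s => v (q.1, s)) q.2
  have hg : ContDiff ℝ ∞ fun q => fderiv ℝ w q (1, 0) := hw.fderiv_apply_const _
  have hgc : HasCompactSupport fun q => fderiv ℝ w q (1, 0) := hwc.fderiv_apply ℝ _
  have smul_out : ∀ (c : ℂ) (u : ℝ → ℂ), Fh h (fun x => c * u x) ξ = c * Fh h u ξ := by
    intro c u
    simp_rw [Fh, mul_left_comm _ c, integral_const_mul]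
    ring
  have hder : ∀ x y, deriv (fun y => iteratedDeriv n (fun s => v (y, s)) x) y =
      fderiv ℝ w (y, x) (1, 0) := fun x y => (hasDerivAt_prodMk_left hw (y, x)).deriv
  have hX : ∀ u : ℝ × ℝ → ℂ, Continuous u → HasCompactSupport u →
      Fh h (Xv f u a b) ξ = ((|a| ^ ((1 : ℝ) / 2) : ℝ) : ℂ) *
        ∫ t, f t * Fh h (fun x => u (b + a * t, x)) ξ := by
    intro u hu huc
    rw [← Fh_integral_swap hf hfc hu huc, ← smul_out]
    congr 1
    exact funext fun x => Xv_eq_integral f u ha b x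
  have hstep : (Complex.I * ξ / h) ^ n * Fh h (Xv f v a b) ξ = Fh h (Xv f w a b) ξ := by
    rw [hX v hv.continuous hvc, hX w hw.continuous hwc, mul_left_comm, ← integral_const_mul]
    congr 2
    ext t
    rw [mul_left_comm, ← Fh_iteratedDeriv (u := fun x => v (b + a * t, x))
      (hv.comp (contDiff_prodMk_right _)) (hvc.comp_prodMk_right _)]
  simp_rw [hstep, hder]
  rw [← Fh_integral_swap hFcont hFc hg.continuous hgc, ← neg_mul, ← smul_out]
  congr 1
  ext x
  rw [Xv_eq_integral f w ha, integral_mul_comp_eq_neg_mul_integral hf hF hFc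
    (u := fun y => w (y, x)) (fun y => hasDerivAt_prodMk_left hw (y, x))
    (hg.continuous.comp (by fun_prop : Continuous fun y : ℝ => (y, x)))]
  ring

theorem lintegral_mul_sq_le {α : Type*} [MeasurableSpace α] {μ : Measure α} {p g : α → ℝ≥0∞}
    (hp : AEMeasurable p μ) (hg : AEMeasurable g μ) :
    (∫⁻ t, p t * g t ∂μ) ^ 2 ≤ (∫⁻ t, p t ∂μ) * ∫⁻ t, p t * g t ^ 2 ∂μ := by
  have hsq : ∀ x : ℝ≥0∞, (x ^ (1 / 2 : ℝ)) ^ 2 = x := fun x => by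
    rw [← ENNReal.rpow_natCast, ← ENNReal.rpow_mul]
    norm_num
  have h := ENNReal.lintegral_mul_norm_pow_le (μ := μ) hp (hp.mul (hg.pow_const 2))
    (p := 1 / 2) (q := 1 / 2) (by norm_num) (by norm_num) (by norm_num)
  have heq : ∀ t, p t ^ (1 / 2 : ℝ) * ((p * fun t => g t ^ 2) t) ^ (1 / 2 : ℝ) = p t * g t := by
    intro t
    rw [← ENNReal.mul_rpow_of_nonneg _ _ (by norm_num), Pi.mul_apply,
      show p t * (p t * g t ^ 2) = (p t * g t) ^ 2 by ring, ← ENNReal.rpow_natCast,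
      ← ENNReal.rpow_mul]
    norm_num
  simp_rw [heq] at h
  calc (∫⁻ t, p t * g t ∂μ) ^ 2 ≤ _ := pow_le_pow_left' h 2
    _ = _ := by rw [mul_pow, hsq, hsq]; rfl

theorem stronglyMeasurable_Fh_slice {g : ℝ × ℝ → ℂ} (hg : Continuous g) (h : ℝ) :
    StronglyMeasurable fun q : ℝ × ℝ => Fh h (fun x => g (q.1, x)) q.2 := by
  have hc : Continuous fun z : (ℝ × ℝ) × ℝ =>
      Complex.exp (-Complex.I * (z.2 : ℂ) * (z.1.2 : ℂ) / (h : ℂ)) * g (z.1.1, z.2) := by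
    fun_prop
  exact (hc.stronglyMeasurable.integral_prod_right' (ν := volume)).const_mul
    (((2 * π * h) ^ (-(1 : ℝ) / 2) : ℝ) : ℂ)

theorem lintegral_enorm_average_sq_le {F : ℝ → ℂ} (hF : Measurable F) {V : ℝ × ℝ → ℂ}
    (hV : Measurable V) (a : ℝ) :
    ∫⁻ p : ℝ × ℝ, ‖∫ t, F t * V (p.2 + a * t, p.1)‖ₑ ^ 2 ≤
      (∫⁻ t, ‖F t‖ₑ) ^ 2 * ∫⁻ q, ‖V q‖ₑ ^ 2 := by
  have hVt : ∀ t : ℝ, Measurable fun p : ℝ × ℝ => ‖V (p.2 + a * t, p.1)‖ₑ ^ 2 :=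
    fun t => (hV.comp (by fun_prop)).enorm.pow_const 2
  have hslice : ∀ t : ℝ, ∫⁻ p : ℝ × ℝ, ‖V (p.2 + a * t, p.1)‖ₑ ^ 2 = ∫⁻ q, ‖V q‖ₑ ^ 2 := by
    intro t
    rw [Measure.volume_eq_prod, lintegral_prod_symm _ (hVt t).aemeasurable,
      lintegral_prod _ (hV.enorm.pow_const 2).aemeasurable]
    exact lintegral_add_right_eq_self (fun y => ∫⁻ x, ‖V (y, x)‖ₑ ^ 2) (a * t)
  have hm : Measurable fun z : (ℝ × ℝ) × ℝ => ‖F z.2‖ₑ * ‖V (z.1.2 + a * z.2, z.1.1)‖ₑ ^ 2 :=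
    (hF.comp measurable_snd).enorm.mul ((hV.comp (by fun_prop)).enorm.pow_const 2)
  calc ∫⁻ p : ℝ × ℝ, ‖∫ t, F t * V (p.2 + a * t, p.1)‖ₑ ^ 2
      ≤ ∫⁻ p : ℝ × ℝ, (∫⁻ t, ‖F t‖ₑ) * ∫⁻ t, ‖F t‖ₑ * ‖V (p.2 + a * t, p.1)‖ₑ ^ 2 := by
        refine lintegral_mono fun p => ?_
        refine (pow_le_pow_left' (enorm_integral_le_lintegral_enorm _) 2).trans ?_
        simp_rw [enorm_mul]
        exact lintegral_mul_sq_le hF.enorm.aemeasurable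
          (hV.comp (by fun_prop)).enorm.aemeasurable
    _ = (∫⁻ t, ‖F t‖ₑ) * ∫⁻ t, ‖F t‖ₑ * ∫⁻ p : ℝ × ℝ, ‖V (p.2 + a * t, p.1)‖ₑ ^ 2 := by
        rw [lintegral_const_mul _ hm.lintegral_prod_right', lintegral_lintegral_swap hm.aemeasurable]
        exact congrArg _ (lintegral_congr fun t => lintegral_const_mul ‖F t‖ₑ (hVt t))
    _ = (∫⁻ t, ‖F t‖ₑ) ^ 2 * ∫⁻ q, ‖V q‖ₑ ^ 2 := by
        simp_rw [hslice]
        rw [lintegral_mul_const _ hF.enorm, ← mul_assoc, sq]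

theorem lintegral_enorm_Fh_slice_sq {g : ℝ × ℝ → ℂ} (hg : ContDiff ℝ ∞ g)
    (hgc : HasCompactSupport g) {h : ℝ} (hh : 0 < h) :
    ∫⁻ q : ℝ × ℝ, ‖Fh h (fun x => g (q.1, x)) q.2‖ₑ ^ 2 = ∫⁻ q, ‖g q‖ₑ ^ 2 := by
  have hV : Measurable fun q : ℝ × ℝ => Fh h (fun x => g (q.1, x)) q.2 :=
    (stronglyMeasurable_Fh_slice hg.continuous h).measurable
  have hslice : ∀ y, ∫⁻ ξ, ‖Fh h (fun x => g (y, x)) ξ‖ₑ ^ 2 = ∫⁻ x, ‖g (y, x)‖ₑ ^ 2 := fun y =>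
    lintegral_enorm_Fh_sq (u := fun x => g (y, x)) hh (hg.comp (contDiff_prodMk_right y))
      (hgc.comp_prodMk_right y)
  have hl := lintegral_prod (μ := (volume : Measure ℝ)) (ν := (volume : Measure ℝ)) _
    (hV.enorm.pow_const 2).aemeasurable
  have hr := lintegral_prod (μ := (volume : Measure ℝ)) (ν := (volume : Measure ℝ)) _
    (hg.continuous.measurable.enorm.pow_const 2).aemeasurable
  simp_rw [hslice] at hl
  exact hl.trans hr.symm

theorem lintegral_enorm_sq_eq_ofReal {g : ℝ × ℝ → ℂ} (hg : Continuous g)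
    (hgc : HasCompactSupport g) :
    ∫⁻ q, ‖g q‖ₑ ^ 2 = ENNReal.ofReal (((∫ q, ‖g q‖ ^ 2) ^ ((1 : ℝ) / 2)) ^ 2) := by
  rw [← Real.sqrt_eq_rpow, Real.sq_sqrt (integral_nonneg fun q => by positivity),
    ofReal_integral_eq_lintegral_ofReal
      ((hg.memLp_of_hasCompactSupport hgc).norm.integrable_sq) (ae_of_all _ fun q => by positivity)]
  simp [ENNReal.ofReal_pow]

theorem norm_cutoff_mul_le {c s ξ h B : ℝ} {z y : ℂ} {n : ℕ} (hh : 0 < h) (hc0 : 0 ≤ c)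
    (hc1 : c ≤ 1) (hξ : c ≠ 0 → 1 / 2 ≤ s * |ξ|) (hs : 0 < s)
    (hz : ‖(Complex.I * ξ / h) ^ n * z‖ = B * ‖y‖) (hB : 0 ≤ B) :
    ‖(c : ℂ) * z‖ ≤ B * (2 * s * h) ^ n * ‖y‖ := by
  rcases eq_or_ne c 0 with rfl | hc
  · simp only [Complex.ofReal_zero, zero_mul, norm_zero]
    positivity
  have h1 : 1 ≤ 2 * s * h * (|ξ| / h) := by
    have : 2 * s * h * (|ξ| / h) = 2 * (s * |ξ|) := by field_simp
    linarith [hξ hc]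
  rw [norm_mul, norm_pow, norm_div, norm_mul, Complex.norm_I, one_mul, Complex.norm_real,
    Complex.norm_real, Real.norm_eq_abs, Real.norm_of_nonneg hh.le] at hz
  calc ‖(c : ℂ) * z‖ ≤ ‖z‖ := by
        rw [norm_mul, Complex.norm_real, Real.norm_of_nonneg hc0]
        exact mul_le_of_le_one_left (norm_nonneg _) hc1
    _ ≤ (2 * s * h * (|ξ| / h)) ^ n * ‖z‖ := le_mul_of_one_le_left (norm_nonneg _) (one_le_pow₀ h1)
    _ = B * (2 * s * h) ^ n * ‖y‖ := by
        rw [mul_pow, mul_assoc, hz]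
        ring

theorem dyadic_factor_le {h : ℝ} (hh : 0 < h) (k M j : ℕ) :
    (2 * ((2 : ℝ) ^ (-(j : ℝ)) * h ^ (-(1 / ((k : ℝ) + 1)))) * h) ^ ((k + 1) * M) * h ^ M ≤
      2 ^ ((k + 1) * M) * (2 : ℝ) ^ (-((j : ℝ) * (M : ℝ))) * h ^ ((k + 1) * M) := by
  have h1 : (h ^ (-(1 / ((k : ℝ) + 1)))) ^ ((k + 1) * M) * h ^ M = 1 := by
    rw [← Real.rpow_natCast, ← Real.rpow_mul hh.le, ← Real.rpow_natCast h M, ← Real.rpow_add hh]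
    push_cast
    field_simp
    simp
  have h2 : ((2 : ℝ) ^ (-(j : ℝ))) ^ ((k + 1) * M) ≤ (2 : ℝ) ^ (-((j : ℝ) * (M : ℝ))) := by
    rw [← Real.rpow_natCast, ← Real.rpow_mul (by norm_num)]
    refine Real.rpow_le_rpow_of_exponent_le (by norm_num) ?_
    push_cast
    nlinarith [show (0 : ℝ) ≤ k * (j * M) by positivity]
  calc _ = 2 ^ ((k + 1) * M) * ((2 : ℝ) ^ (-(j : ℝ))) ^ ((k + 1) * M) * h ^ ((k + 1) * M) *
        ((h ^ (-(1 / ((k : ℝ) + 1)))) ^ ((k + 1) * M) * h ^ M) := by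
        simp only [mul_pow]
        ring
    _ ≤ _ := by
        rw [h1, mul_one]
        gcongr

theorem sqrt_integral_norm_sq_le {α : Type*} [MeasurableSpace α] {μ : Measure α} {G H : α → ℂ}
    {K I : ℝ} (hK : 0 ≤ K) (hI : 0 ≤ I) (hGH : ∀ p, ‖G p‖ ≤ K * ‖H p‖)
    (hH : ∫⁻ p, ‖H p‖ₑ ^ 2 ∂μ ≤ ENNReal.ofReal (I ^ 2)) :
    (∫ p, ‖G p‖ ^ 2 ∂μ) ^ ((1 : ℝ) / 2) ≤ K * I := by
  have h1 : ∫ p, ‖G p‖ ^ 2 ∂μ ≤ (K * I) ^ 2 := by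
    have hnn : 0 ≤ ∫ p, ‖G p‖ ^ 2 ∂μ := integral_nonneg fun p => by positivity
    rw [← ENNReal.ofReal_le_ofReal_iff (by positivity), ← Real.enorm_of_nonneg hnn]
    refine (enorm_integral_le_lintegral_enorm _).trans ?_
    rw [mul_pow, ENNReal.ofReal_mul (by positivity)]
    refine le_trans ?_ (mul_le_mul_right hH _)
    rw [← lintegral_const_mul' _ _ ENNReal.ofReal_ne_top]
    refine lintegral_mono fun p => ?_
    rw [Real.enorm_of_nonneg (by positivity), ← ofReal_norm, ← ENNReal.ofReal_pow (norm_nonneg _),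
      ← ENNReal.ofReal_mul (by positivity), ← mul_pow]
    exact ENNReal.ofReal_le_ofReal (pow_le_pow_left₀ (norm_nonneg _) (hGH p) 2)
  rw [← Real.sqrt_eq_rpow]
  exact Real.sqrt_le_iff.2 ⟨by positivity, h1⟩

/-- Dyadic wavelet-coefficient estimate (small scales `0 < |a| ≤ 1`): if `v` is a
strong joint order-`h` quasimode of `hD_{x₁}` and `h^{k+1}D_{x₂}^{k+1}` of size `N`,
i.e. `‖∂_{x₁}(h^{k+1}∂_{x₂}^{k+1})^{M} v‖_{L²} ≤ A_M h^M N` for all `M`, then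
`‖χ(2⁻ʲh^{-1/(k+1)}|ξ₂|) F_h[X_v(a,b,·)](ξ₂)‖_{L²(dξ₂ db)} ≤ C_M 2^{-jM} |a|^{3/2} N`. -/
theorem Xv_dyadic_L2_bound_small_a
    (k : ℕ) (hk : 1 ≤ k) (A : ℕ → ℝ)
    (f : ℝ → ℂ) (hf : ContDiff ℝ (⊤ : ℕ∞) f) (hfc : HasCompactSupport f)
    (hf0 : ∫ t : ℝ, f t = 0)
    (χ : ℝ → ℝ) (hχ : ContDiff ℝ (⊤ : ℕ∞) χ)
    (hχ0 : ∀ t, 0 ≤ χ t) (hχ1 : ∀ t, χ t ≤ 1)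
    (hχs : tsupport χ ⊆ Set.Icc (1 / 2 : ℝ) (3 / 2))
    (M : ℕ) :
    ∃ C : ℝ, 0 < C ∧
      ∀ h : ℝ, 0 < h → h ≤ 1 → ∀ N : ℝ, 0 < N →
      ∀ v : ℝ × ℝ → ℂ, ContDiff ℝ (⊤ : ℕ∞) v → HasCompactSupport v →
      -- strong joint quasimode hypothesis: ‖∂_{x₁}(h^{k+1}∂_{x₂}^{k+1})^{M'} v‖_{L²} ≤ A_{M'} h^{M'} N
      (∀ M' : ℕ,
        h ^ ((k + 1) * M') *
            (∫ q : ℝ × ℝ,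
                ‖deriv (fun t => iteratedDeriv ((k + 1) * M') (fun s => v (t, s)) q.2)
                    q.1‖ ^ 2) ^ ((1 : ℝ) / 2) ≤
          A M' * h ^ M' * N) →
      ∀ j : ℕ, 1 ≤ j → ∀ a : ℝ, a ≠ 0 → |a| ≤ 1 →
        (∫ p : ℝ × ℝ,
            ‖((χ ((2 : ℝ) ^ (-(j : ℝ)) * h ^ (-(1 / ((k : ℝ) + 1))) * |p.1|) : ℝ) : ℂ) *
                Fh h (Xv f v a p.2) p.1‖ ^ 2) ^ ((1 : ℝ) / 2) ≤
          C * (2 : ℝ) ^ (-((j : ℝ) * (M : ℝ))) * |a| ^ ((3 : ℝ) / 2) * N := by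
  obtain ⟨F, hF, hFc⟩ := exists_hasCompactSupport_antiderivative hf.continuous hfc hf0
  have hFcont : Continuous F := continuous_iff_continuousAt.2 fun t => (hF t).continuousAt
  set S : ℝ := ∫ t, ‖F t‖
  have hS0 : 0 ≤ S := integral_nonneg fun t => norm_nonneg _
  have hSe : ∫⁻ t, ‖F t‖ₑ = ENNReal.ofReal S :=
    (ofReal_integral_norm_eq_lintegral_enorm
      (hFcont.integrable_of_hasCompactSupport hFc)).symm
  refine ⟨2 ^ ((k + 1) * M) * S * |A M| + 1, by positivity, ?_⟩
  intro h hh _ N hN v hv hvc hquasi j _ a ha _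
  obtain ⟨hw, hwc⟩ := contDiff_hasCompactSupport_iteratedDeriv_snd hv hvc ((k + 1) * M)
  set g : ℝ × ℝ → ℂ := fun q =>
    deriv (fun t => iteratedDeriv ((k + 1) * M) (fun s => v (t, s)) q.2) q.1
  have hgfd : g = fun q => fderiv ℝ
      (fun q : ℝ × ℝ => iteratedDeriv ((k + 1) * M) (fun s => v (q.1, s)) q.2) q (1, 0) :=
    funext fun q => (hasDerivAt_prodMk_left hw q).deriv
  have hg : ContDiff ℝ ∞ g := hgfd ▸ hw.fderiv_apply_const _
  have hgc : HasCompactSupport g := hgfd ▸ hwc.fderiv_apply ℝ _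
  set G : ℝ := (∫ q, ‖g q‖ ^ 2) ^ ((1 : ℝ) / 2)
  have hG0 : 0 ≤ G := Real.rpow_nonneg (integral_nonneg fun q => by positivity) _
  set s : ℝ := (2 : ℝ) ^ (-(j : ℝ)) * h ^ (-(1 / ((k : ℝ) + 1)))
  have hs0 : 0 < s := by positivity
  have hpow : |a| ^ ((3 : ℝ) / 2) = |a| ^ ((1 : ℝ) / 2) * |a| := by
    rw [← Real.rpow_add_one (abs_pos.2 ha).ne']
    norm_num
  have hbound := sqrt_integral_norm_sq_le (μ := volume)
    (G := fun p : ℝ × ℝ => ((χ (s * |p.1|) : ℝ) : ℂ) * Fh h (Xv f v a p.2) p.1)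
    (H := fun p : ℝ × ℝ => ∫ t, F t * Fh h (fun x => g (p.2 + a * t, x)) p.1)
    (K := |a| ^ ((3 : ℝ) / 2) * (2 * s * h) ^ ((k + 1) * M)) (I := S * G)
    (by positivity) (by positivity)
    (fun p => norm_cutoff_mul_le hh (hχ0 _) (hχ1 _)
      (fun hne => (hχs (subset_tsupport χ hne)).1) hs0 (by
        rw [Fh_Xv_eq hf.continuous hF hFc hv hvc ha, norm_neg, norm_mul, norm_mul,
          Complex.norm_real, Complex.norm_real, Real.norm_of_nonneg (by positivity),
          Real.norm_eq_abs, hpow]) (by positivity))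
    (by
      refine (lintegral_enorm_average_sq_le hFcont.measurable
        (stronglyMeasurable_Fh_slice hg.continuous h).measurable a).trans_eq ?_
      rw [lintegral_enorm_Fh_slice_sq hg hgc hh, hSe,
        lintegral_enorm_sq_eq_ofReal hg.continuous hgc, mul_pow,
        ENNReal.ofReal_mul (by positivity), ENNReal.ofReal_pow hS0])
  refine hbound.trans ?_
  have hq : h ^ ((k + 1) * M) * G ≤ |A M| * h ^ M * N :=
    (hquasi M).trans (by gcongr; exact le_abs_self _)
  have hsG : (2 * s * h) ^ ((k + 1) * M) * G ≤
      2 ^ ((k + 1) * M) * (2 : ℝ) ^ (-((j : ℝ) * (M : ℝ))) * (|A M| * N) := by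
    refine le_of_mul_le_mul_right ?_ (pow_pos hh M)
    calc (2 * s * h) ^ ((k + 1) * M) * G * h ^ M
        = (2 * s * h) ^ ((k + 1) * M) * h ^ M * G := by ring
      _ ≤ 2 ^ ((k + 1) * M) * (2 : ℝ) ^ (-((j : ℝ) * (M : ℝ))) * h ^ ((k + 1) * M) * G :=
          mul_le_mul_of_nonneg_right (dyadic_factor_le hh k M j) hG0
      _ = 2 ^ ((k + 1) * M) * (2 : ℝ) ^ (-((j : ℝ) * (M : ℝ))) * (h ^ ((k + 1) * M) * G) := by ring
      _ ≤ 2 ^ ((k + 1) * M) * (2 : ℝ) ^ (-((j : ℝ) * (M : ℝ))) * (|A M| * h ^ M * N) := by gcongr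
      _ = _ := by ring
  calc |a| ^ ((3 : ℝ) / 2) * (2 * s * h) ^ ((k + 1) * M) * (S * G)
      = |a| ^ ((3 : ℝ) / 2) * S * ((2 * s * h) ^ ((k + 1) * M) * G) := by ring
    _ ≤ |a| ^ ((3 : ℝ) / 2) * S *
        (2 ^ ((k + 1) * M) * (2 : ℝ) ^ (-((j : ℝ) * (M : ℝ))) * (|A M| * N)) := by gcongr
    _ = 2 ^ ((k + 1) * M) * S * |A M| * (2 : ℝ) ^ (-((j : ℝ) * (M : ℝ))) *
        |a| ^ ((3 : ℝ) / 2) * N := by ring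
    _ ≤ _ := by
        gcongr
        linarith
end
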